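/- arXiv:2511.21144 — 4 statements merged into one kernel-verified Lean document; each statement's English description precedes it below -/
import Mathlib

section
/- Let k ≥ 3 and g ≥ 3 be integers, set t = ⌊g/2⌋, and let d be an integer with t ≤ d ≤ 2t. Then every finite k-regular simple graph with girth exactly g and diameter exactly d has at least M(k,g) + M(k, 2d−2t−1) vertices. -/
/-- The Moore bound `M(k,g)`, with the convention `M(k,g) = 0` for `g ≤ 0`. -/
def mooreBound (k : ℕ) (g : ℤ) : ℕ :=
  if g ≤ 0 then 0
  else if g % 2 = 1 then
    1 + k * ∑ i ∈ Finset.range ((g - 1) / 2).toNat, (k - 1) ^ i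
  else
    2 * ∑ i ∈ Finset.range (g / 2).toNat, (k - 1) ^ i

/-- A graph is `k`-regular: every vertex has exactly `k` neighbours. -/
def IsRegular' (k : ℕ) {V : Type*} (G : SimpleGraph V) : Prop :=
  ∀ v : V, (G.neighborSet v).ncard = k

/-- A `(k; g, d)`-graph: a `k`-regular simple graph of girth exactly `g` and
diameter exactly `d`. -/
def IsKGDGraph (k g d : ℕ) {V : Type*} (G : SimpleGraph V) : Prop :=
  IsRegular' k G ∧ G.egirth = g ∧ G.ediam = d

namespace SimpleGraph

variable {V : Type*} {G : SimpleGraph V}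

/-- Two distinct paths with common endpoints yield a cycle no longer than their total length. -/
lemma egirth_le_length_add_length_of_isPath_of_ne {u v : V} {p q : G.Walk u v}
    (hp : p.IsPath) (hq : q.IsPath) (hne : p ≠ q) :
    G.egirth ≤ (p.length + q.length : ℕ) := by
  classical
  let H : SimpleGraph V := fromEdgeSet {e | e ∈ p.edges ∨ e ∈ q.edges}
  have hpH : ∀ e ∈ p.edges, e ∈ H.edgeSet := fun e he ↦ by
    simp only [H, edgeSet_fromEdgeSet]
    exact ⟨Or.inl he, G.not_isDiag_of_mem_edgeSet (p.edges_subset_edgeSet he)⟩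
  have hqH : ∀ e ∈ q.edges, e ∈ H.edgeSet := fun e he ↦ by
    simp only [H, edgeSet_fromEdgeSet]
    exact ⟨Or.inr he, G.not_isDiag_of_mem_edgeSet (q.edges_subset_edgeSet he)⟩
  have hHG : H ≤ G := by
    rw [← edgeSet_subset_edgeSet]
    intro e he
    simp only [H, edgeSet_fromEdgeSet] at he
    exact he.1.elim (fun h ↦ p.edges_subset_edgeSet h) (fun h ↦ q.edges_subset_edgeSet h)
  have hcyc : ¬ H.IsAcyclic := by
    intro hH
    have h := congrArg Subtype.val
      ((hH.subsingleton_path u v).elim ⟨p.transfer H hpH, hp.transfer hpH⟩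
        ⟨q.transfer H hqH, hq.transfer hqH⟩)
    apply hne
    have h2 := congrArg Walk.support h
    simp only [Walk.support_transfer] at h2
    exact Walk.ext_support h2
  simp only [IsAcyclic, not_forall, not_not] at hcyc
  obtain ⟨a, c, hc⟩ := hcyc
  have hlen : c.length ≤ p.length + q.length := by
    have hsub : c.edges ⊆ p.edges ++ q.edges := fun e he ↦ by
      have := c.edges_subset_edgeSet he
      simp only [H, edgeSet_fromEdgeSet] at this
      exact List.mem_append.2 this.1
    simpa using (hc.isCircuit.isTrail.edges_nodup.subperm hsub).length_le
  calc G.egirth ≤ H.egirth := egirth_anti hHG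
    _ ≤ c.length := egirth_le_length hc
    _ ≤ _ := by exact_mod_cast hlen

/-- In a graph of large girth, a vertex has at most one neighbour that is not farther from
the root `u` than the vertex itself. -/
lemma Connected.eq_of_adj_of_dist_le (hc : G.Connected) {u x y z : V}
    (hy : G.Adj y x) (hz : G.Adj z x) (hyx : G.dist u y ≤ G.dist u x)
    (hzx : G.dist u z ≤ G.dist u x)
    (hg : ((G.dist u y + G.dist u z + 2 : ℕ) : ℕ∞) < G.egirth) : y = z := by
  classical
  have key : ∀ w, G.Adj w x → G.dist u w ≤ G.dist u x → ∀ p : G.Walk u w,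
      p.length = G.dist u w → x ∉ p.support := by
    intro w hw hwx p hp hx
    have h1 := dist_le (p.takeUntil x hx)
    have h2 := congrArg Walk.length (p.take_spec hx)
    rw [Walk.length_append] at h2
    have h3 : (p.dropUntil x hx).length = 0 := by omega
    exact hw.ne (Walk.eq_of_length_eq_zero h3).symm
  obtain ⟨p, hp, hpl⟩ := hc.exists_path_of_dist u y
  obtain ⟨q, hq, hql⟩ := hc.exists_path_of_dist u z
  by_contra hne
  have hcp := hp.concat (key y hy hyx p hpl) hy
  have hcq := hq.concat (key z hz hzx q hql) hz
  have hpq : p.concat hy ≠ q.concat hz := fun h ↦ hne (Walk.concat_inj h).1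
  have := egirth_le_length_add_length_of_isPath_of_ne hcp hcq hpq
  rw [Walk.length_concat, Walk.length_concat, hpl, hql] at this
  refine absurd (hg.trans_le this) ?_
  rw [Nat.cast_lt]
  omega

/-- The distances from a fixed root to two adjacent vertices differ by at most one. -/
lemma Connected.dist_le_dist_add_one (hc : G.Connected) {u x y : V} (h : G.Adj x y) :
    G.dist u y ≤ G.dist u x + 1 := by
  have := hc.dist_triangle (u := u) (v := x) (w := y)
  rwa [dist_eq_one_iff_adj.2 h] at this

/-- Double counting the edges between two vertex sets. -/
lemma card_mul_pred_le_card [Fintype V] [DecidableRel G.Adj] {k : ℕ}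
    (hreg : G.IsRegularOfDegree k) {A B : Finset V}
    (hA : ∀ x ∈ A, ∀ y z, G.Adj x y → G.Adj x z → y ∉ B → z ∉ B → y = z)
    (hB : ∀ y ∈ B, ∀ x ∈ A, ∀ z ∈ A, G.Adj x y → G.Adj z y → x = z) :
    A.card * (k - 1) ≤ B.card := by
  classical
  rw [← mul_one B.card]
  apply Finset.card_mul_le_card_mul G.Adj
  · intro x hx
    have h1 : (G.neighborFinset x \ B).card ≤ 1 := by
      refine Finset.card_le_one.2 fun y hy z hz ↦ ?_
      simp only [Finset.mem_sdiff, mem_neighborFinset] at hy hz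
      exact hA x hx y z hy.1 hz.1 hy.2 hz.2
    have h2 : B.bipartiteAbove G.Adj x = G.neighborFinset x ∩ B := by
      ext y
      simp [Finset.mem_bipartiteAbove, and_comm]
    have h3 := Finset.card_inter_add_card_sdiff (G.neighborFinset x) B
    rw [card_neighborFinset_eq_degree, hreg x] at h3
    rw [h2]
    omega
  · intro y hy
    refine Finset.card_le_one.2 fun x hx z hz ↦ ?_
    simp only [Finset.mem_bipartiteBelow] at hx hz
    exact hB y hy x hx.1 z hz.1 hx.2 hz.2

section Counting

variable [Fintype V] [DecidableRel G.Adj] {k : ℕ}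

/-- Lower bound for the size of a sphere in a regular graph of large girth. -/
lemma Connected.le_card_sphere (hc : G.Connected) (hreg : G.IsRegularOfDegree k) (u : V) (i : ℕ)
    (hg : ((2 * (i + 1) : ℕ) : ℕ∞) < G.egirth) :
    k * (k - 1) ^ i ≤ (Finset.univ.filter fun x ↦ G.dist u x = i + 1).card := by
  induction i with
  | zero =>
    have : (Finset.univ.filter fun x ↦ G.dist u x = 0 + 1) = G.neighborFinset u := by
      ext x
      simp [dist_eq_one_iff_adj]
    rw [this, card_neighborFinset_eq_degree, hreg u]
    simp
  | succ i ih =>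
    have hlt : ∀ n : ℕ, n ≤ 2 * (i + 1 + 1) → (n : ℕ∞) < G.egirth :=
      fun n hn ↦ (Nat.cast_le.2 hn).trans_lt hg
    rw [pow_succ, ← mul_assoc]
    refine (Nat.mul_le_mul_right _ (ih (hlt _ (by omega)))).trans ?_
    apply card_mul_pred_le_card hreg
    · intro x hx y z hy hz hyB hzB
      simp only [Finset.mem_filter, Finset.mem_univ, true_and] at hx hyB hzB
      have h1 := hc.dist_le_dist_add_one (u := u) hy
      have h2 := hc.dist_le_dist_add_one (u := u) hz
      exact hc.eq_of_adj_of_dist_le (u := u) hy.symm hz.symm (by omega) (by omega)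
        (hlt _ (by omega))
    · intro y hy x hx z hz hxy hzy
      simp only [Finset.mem_filter, Finset.mem_univ, true_and] at hx hy hz
      exact hc.eq_of_adj_of_dist_le (u := u) hxy hzy (by omega) (by omega) (hlt _ (by omega))

/-- The Moore bound for balls in a regular graph of large girth. -/
lemma Connected.le_card_ball (hc : G.Connected) (hreg : G.IsRegularOfDegree k) (u : V) (r : ℕ)
    (hg : ((2 * r : ℕ) : ℕ∞) < G.egirth) :
    1 + k * ∑ i ∈ Finset.range r, (k - 1) ^ i
      ≤ (Finset.univ.filter fun x ↦ G.dist u x ≤ r).card := by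
  classical
  induction r with
  | zero =>
    simp only [Finset.range_zero, Finset.sum_empty, mul_zero, add_zero]
    exact Finset.card_pos.2 ⟨u, by simp⟩
  | succ r ih =>
    have h1 := ih ((Nat.cast_le.2 (by omega)).trans_lt hg)
    have h2 := hc.le_card_sphere hreg u r hg
    have h3 : (Finset.univ.filter fun x ↦ G.dist u x ≤ r + 1)
        = (Finset.univ.filter fun x ↦ G.dist u x ≤ r)
          ∪ (Finset.univ.filter fun x ↦ G.dist u x = r + 1) := by
      ext x
      simp only [Finset.mem_filter, Finset.mem_univ, true_and, Finset.mem_union]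
      omega
    rw [h3, Finset.card_union_of_disjoint, Finset.sum_range_succ, mul_add]
    · omega
    · refine Finset.disjoint_left.2 fun x hx hx' ↦ ?_
      simp only [Finset.mem_filter, Finset.mem_univ, true_and] at hx hx'
      omega

/-- Lower bound for the part of a sphere around `u` lying behind a given neighbour `w` of `u`. -/
lemma Connected.le_card_branch (hc : G.Connected) (hreg : G.IsRegularOfDegree k) {u w : V}
    (huw : G.Adj u w) (i : ℕ) (hg : ((2 * i + 1 : ℕ) : ℕ∞) < G.egirth) :
    (k - 1) ^ i ≤ (Finset.univ.filter fun x ↦ G.dist u x = i + 1 ∧ G.dist w x = i).card := by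
  induction i with
  | zero =>
    rw [pow_zero]
    exact Finset.card_pos.2 ⟨w, by simp [dist_eq_one_iff_adj.2 huw]⟩
  | succ i ih =>
    have hlt : ∀ n : ℕ, n ≤ 2 * (i + 1) + 1 → (n : ℕ∞) < G.egirth :=
      fun n hn ↦ (Nat.cast_le.2 hn).trans_lt hg
    rw [pow_succ]
    refine (Nat.mul_le_mul_right _ (ih (hlt _ (by omega)))).trans ?_
    apply card_mul_pred_le_card hreg
    · intro x hx y z hy hz hyB hzB
      simp only [Finset.mem_filter, Finset.mem_univ, true_and] at hx hyB hzB
      obtain ⟨a, hax, hua⟩ : ∃ a, G.Adj a x ∧ G.dist u a = i := by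
        obtain ⟨p, hp⟩ := hc.exists_walk_length_eq_dist u x
        have hn : ¬ p.Nil := fun h ↦ by
          have := Walk.length_eq_zero_iff.2 h
          omega
        refine ⟨p.penultimate, p.adj_penultimate hn, ?_⟩
        have h1 := dist_le p.dropLast
        have h2 := hc.dist_le_dist_add_one (u := u) (p.adj_penultimate hn)
        have h3 : p.dropLast.length + 1 = p.length := p.length_dropLast_add_one hn
        omega
      have key : ∀ b, G.Adj x b → ¬(G.dist u b = i + 1 + 1 ∧ G.dist w b = i + 1) → b = a := by
        intro b hb hbB
        have h1 := hc.dist_le_dist_add_one (u := u) hb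
        have h2 := hc.dist_le_dist_add_one (u := w) hb
        have h3 := hc.dist_triangle (u := u) (v := w) (w := b)
        rw [dist_eq_one_iff_adj.2 huw] at h3
        exact hc.eq_of_adj_of_dist_le (u := u) hb.symm hax (by omega) (by omega)
          (hlt _ (by omega))
      rw [key y hy hyB, key z hz hzB]
    · intro y hy x hx z hz hxy hzy
      simp only [Finset.mem_filter, Finset.mem_univ, true_and] at hx hy hz
      exact hc.eq_of_adj_of_dist_le (u := w) hxy hzy (by omega) (by omega) (hlt _ (by omega))

end Counting

end SimpleGraph

lemma mooreBound_odd (k r : ℕ) :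
    mooreBound k (2 * (r : ℤ) + 1) = 1 + k * ∑ i ∈ Finset.range r, (k - 1) ^ i := by
  have h : ((2 * (r : ℤ) + 1 - 1) / 2).toNat = r := by omega
  rw [mooreBound, if_neg (by omega), if_pos (by omega), h]

lemma mooreBound_even (k r : ℕ) :
    mooreBound k (2 * (r : ℤ)) = 2 * ∑ i ∈ Finset.range r, (k - 1) ^ i := by
  rcases Nat.eq_zero_or_pos r with rfl | hr
  · simp [mooreBound]
  have h : (2 * (r : ℤ) / 2).toNat = r := by omega
  rw [mooreBound, if_neg (by omega), if_neg (by omega), h]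

lemma mooreBound_even_eq_odd_add (k r : ℕ) (hk : 1 ≤ k) :
    mooreBound k (2 * ((r + 1 : ℕ) : ℤ)) = mooreBound k (2 * (r : ℤ) + 1) + (k - 1) ^ r := by
  obtain ⟨q, rfl⟩ := Nat.exists_eq_add_of_le' hk
  rw [mooreBound_even, mooreBound_odd, Nat.add_sub_cancel]
  have h1 := Finset.sum_range_succ (fun i ↦ q ^ i) r
  have h2 := geom_sum_succ (x := q) (n := r)
  linarith

/-- The Moore bound holds already for the ball of radius `g / 2` around any vertex. -/
lemma mooreBound_le_card_ball {V : Type*} [Fintype V] {G : SimpleGraph V} [DecidableRel G.Adj]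
    {k g : ℕ} (hk : 1 ≤ k) (hg : 2 ≤ g) (hc : G.Connected) (hreg : G.IsRegularOfDegree k)
    (hG : (g : ℕ∞) ≤ G.egirth) (u : V) :
    mooreBound k g ≤ (Finset.univ.filter fun x ↦ G.dist u x ≤ g / 2).card := by
  classical
  have hlt : ∀ n : ℕ, n < g → (n : ℕ∞) < G.egirth :=
    fun n hn ↦ (Nat.cast_lt.2 hn).trans_le hG
  rcases Nat.even_or_odd' g with ⟨t, rfl | rfl⟩
  · obtain ⟨r, rfl⟩ := Nat.exists_eq_add_of_le' (show 1 ≤ t by omega)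
    obtain ⟨w, hw⟩ : (G.neighborFinset u).Nonempty := by
      rw [← Finset.card_pos, SimpleGraph.card_neighborFinset_eq_degree, hreg u]
      exact hk
    rw [SimpleGraph.mem_neighborFinset] at hw
    have h1 := hc.le_card_ball hreg u r (hlt _ (by omega))
    have h2 := hc.le_card_branch hreg hw r (hlt _ (by omega))
    rw [← mooreBound_odd] at h1
    rw [Nat.cast_mul, Nat.cast_ofNat, mooreBound_even_eq_odd_add k r hk]
    refine (add_le_add h1 h2).trans ?_
    rw [← Finset.card_union_of_disjoint]
    · refine Finset.card_le_card fun x hx ↦ ?_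
      simp only [Finset.mem_filter, Finset.mem_univ, true_and, Finset.mem_union] at hx ⊢
      omega
    · refine Finset.disjoint_left.2 fun x hx hx' ↦ ?_
      simp only [Finset.mem_filter, Finset.mem_univ, true_and] at hx hx'
      omega
  · have h1 := hc.le_card_ball hreg u t (hlt _ (by omega))
    rw [← mooreBound_odd] at h1
    have h2 : (2 * t + 1) / 2 = t := by omega
    rw [h2]
    exact_mod_cast h1

theorem moore_bound_small_diameter (k g d t : ℕ) (hk : 3 ≤ k) (hg : 3 ≤ g)
    (ht : t = g / 2) (hd1 : t ≤ d) (hd2 : d ≤ 2 * t)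
    {V : Type*} [Fintype V] (G : SimpleGraph V) (hG : IsKGDGraph k g d G) :
    mooreBound k g + mooreBound k (2 * (d : ℤ) - 2 * t - 1) ≤ Fintype.card V := by
  classical
  obtain ⟨hreg', hgirth, hdiam⟩ := hG
  have hreg : G.IsRegularOfDegree k := fun v ↦ by
    rw [← hreg' v, Set.ncard_eq_toFinset_card', ← SimpleGraph.card_neighborFinset_eq_degree]
    rfl
  have : Nontrivial V := SimpleGraph.nontrivial_of_ediam_ne_zero (G := G) (by
    rw [hdiam]
    exact_mod_cast (show d ≠ 0 by omega))
  have htop : G.ediam ≠ ⊤ := by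
    rw [hdiam]
    exact ENat.natCast_ne_top d
  have hc := SimpleGraph.connected_of_ediam_ne_top htop
  obtain ⟨u, v, huv⟩ := SimpleGraph.exists_edist_eq_ediam_of_ne_top htop
  have hdist : G.dist u v = d := by
    rw [SimpleGraph.dist, huv, hdiam, ENat.toNat_natCast]
  have h1 := mooreBound_le_card_ball (by omega) (by omega) hc hreg hgirth.ge u
  rcases hd1.eq_or_lt with rfl | hlt
  · have h2 : mooreBound k (2 * (t : ℤ) - 2 * t - 1) = 0 := by
      rw [mooreBound, if_pos (by omega)]
    rw [h2, add_zero]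
    exact h1.trans (Finset.card_le_univ _)
  · obtain ⟨r, hr⟩ := Nat.exists_eq_add_of_lt hlt
    have h2 := hc.le_card_ball hreg v r (by
      rw [hgirth]
      exact Nat.cast_lt.2 (by omega))
    rw [← mooreBound_odd] at h2
    have h3 : 2 * (d : ℤ) - 2 * t - 1 = 2 * (r : ℤ) + 1 := by omega
    rw [h3]
    refine (add_le_add h1 h2).trans ?_
    rw [← Finset.card_union_of_disjoint]
    · exact Finset.card_le_univ _
    · refine Finset.disjoint_left.2 fun x hx hx' ↦ ?_
      simp only [Finset.mem_filter, Finset.mem_univ, true_and] at hx hx'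
      have h4 := hc.dist_triangle (u := u) (v := x) (w := v)
      rw [SimpleGraph.dist_comm (u := x)] at h4
      omega
end

section
/- Let k ≥ 3 and g ≥ 3 be integers, set t = ⌊g/2⌋, and let d = 2t+1+rg+s where r ≥ 0 and 0 ≤ s ≤ g−1 are integers. Then every finite k-regular simple graph with girth exactly g and diameter exactly d has at least (r+2)·M(k,g) + M(k,s) vertices. -/
open SimpleGraph

theorem path_eq_of_length_add_lt_egirth {V : Type*} {G : SimpleGraph V} {u v : V}
    {p q : G.Walk u v} (hp : p.IsPath) (hq : q.IsPath)
    (h : ((p.length + q.length : ℕ) : ℕ∞) < G.egirth) : p = q := by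
  by_contra hne
  obtain ⟨u', v', p', q', hp', hq', hc⟩ := hp.exists_isCycle_of_ne hq hne
  have h1 := egirth_le_length hc
  have h2 : (p'.append q'.reverse).length ≤ p.length + q.length := by
    rw [Walk.length_append, Walk.length_reverse]
    exact Nat.add_le_add (Walk.length_le_of_isSubwalk hp') (Walk.length_le_of_isSubwalk hq')
  exact absurd (h.trans_le h1) (not_lt.mpr (by exact_mod_cast h2))

open Classical in
/-- The vertices reached from `w` by a path of length at most `n` avoiding `u`. -/
noncomputable def branch {V : Type*} [Fintype V] (G : SimpleGraph V) (n : ℕ) (u w : V) :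
    Finset V :=
  {z | ∃ q : G.Walk w z, q.IsPath ∧ u ∉ q.support ∧ q.length ≤ n}

theorem mem_branch {V : Type*} [Fintype V] {G : SimpleGraph V} {n : ℕ} {u w z : V} :
    z ∈ branch G n u w ↔ ∃ q : G.Walk w z, q.IsPath ∧ u ∉ q.support ∧ q.length ≤ n := by
  simp [branch]

theorem disjoint_branch_of_ne {V : Type*} [Fintype V] {G : SimpleGraph V} {n : ℕ} {v x y : V}
    (h : ((2 * (n + 1) : ℕ) : ℕ∞) < G.egirth) (hx : G.Adj v x) (hy : G.Adj v y) (hxy : x ≠ y) :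
    Disjoint (branch G n v x) (branch G n v y) := by
  rw [Finset.disjoint_left]
  intro z hzx hzy
  obtain ⟨p, hp, hvp, hpn⟩ := mem_branch.1 hzx
  obtain ⟨q, hq, hvq, hqn⟩ := mem_branch.1 hzy
  have heq := path_eq_of_length_add_lt_egirth (hp.cons (h := hx) hvp) (hq.cons (h := hy) hvq)
    (lt_of_le_of_lt (by simp only [Walk.length_cons]; exact_mod_cast (by omega)) h)
  injection heq
  exact hxy ‹_›

theorem disjoint_branch_swap {V : Type*} [Fintype V] {G : SimpleGraph V} {n : ℕ} {u w : V}
    (h : ((2 * n + 1 : ℕ) : ℕ∞) < G.egirth) (huw : G.Adj u w) :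
    Disjoint (branch G n u w) (branch G n w u) := by
  rw [Finset.disjoint_left]
  intro z hz hz'
  obtain ⟨p, hp, hup, hpn⟩ := mem_branch.1 hz
  obtain ⟨q, hq, hwq, hqn⟩ := mem_branch.1 hz'
  have heq := path_eq_of_length_add_lt_egirth (hp.cons (h := huw) hup) hq
    (lt_of_le_of_lt (by simp only [Walk.length_cons]; exact_mod_cast (by omega)) h)
  apply hwq
  rw [← heq]
  simp

open Classical in
theorem one_add_sum_card_branch {V : Type*} [Fintype V] {G : SimpleGraph V} {n : ℕ} {v : V}
    (h : ((2 * (n + 1) : ℕ) : ℕ∞) < G.egirth) {s : Finset V} (hs : ∀ x ∈ s, G.Adj v x) :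
    (insert v (s.biUnion (branch G n v))).card = 1 + ∑ x ∈ s, (branch G n v x).card := by
  rw [Finset.card_insert_of_notMem, Finset.card_biUnion, add_comm]
  · exact fun x hx y hy hxy => disjoint_branch_of_ne h (hs x hx) (hs y hy) hxy
  · simp only [Finset.mem_biUnion, mem_branch, not_exists, not_and]
    exact fun x _ q _ hq => absurd q.end_mem_support hq

theorem branch_subset_branch_succ {V : Type*} [Fintype V] {G : SimpleGraph V} {n : ℕ} {u w x : V}
    (h : ((2 * (n + 1) : ℕ) : ℕ∞) < G.egirth) (hwu : G.Adj w u) (hwx : G.Adj w x) (hxu : x ≠ u) :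
    branch G n w x ⊆ branch G (n + 1) u w := by
  classical
  intro z hz
  obtain ⟨q, hq, hwq, hqn⟩ := mem_branch.1 hz
  refine mem_branch.2 ⟨Walk.cons hwx q, hq.cons hwq, fun hu => ?_, by simpa using hqn⟩
  rw [Walk.support_cons, List.mem_cons] at hu
  rcases hu with hu | hu
  · exact hwu.ne hu.symm
  · refine Finset.disjoint_left.1 (disjoint_branch_of_ne h hwx hwu hxu)
      (mem_branch.2 ⟨q.takeUntil u hu, hq.takeUntil hu,
        fun hw => hwq (q.support_takeUntil_subset_support hu hw),
        (q.length_takeUntil_le_length hu).trans hqn⟩)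
      (mem_branch.2 ⟨Walk.nil, by simp, by simpa using hwu.ne, by simp⟩)

open Classical in
theorem IsRegular'.card_neighborFinset {k : ℕ} {V : Type*} [Fintype V] {G : SimpleGraph V}
    (hG : IsRegular' k G) (v : V) : (G.neighborFinset v).card = k := by
  rw [← hG v, Set.ncard_eq_toFinset_card', neighborFinset]

theorem geom_sum_le_card_branch {k : ℕ} {V : Type*} [Fintype V] {G : SimpleGraph V}
    (hG : IsRegular' k G) {n : ℕ} (h : ((2 * n : ℕ) : ℕ∞) < G.egirth) {u w : V}
    (huw : G.Adj u w) :
    ∑ i ∈ Finset.range (n + 1), (k - 1) ^ i ≤ (branch G n u w).card := by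
  classical
  induction n generalizing u w with
  | zero =>
    have : w ∈ branch G 0 u w := mem_branch.2 ⟨Walk.nil, by simp, by simpa using huw.ne, by simp⟩
    simpa using Finset.card_pos.2 ⟨w, this⟩
  | succ n ih =>
    have hn : ((2 * n : ℕ) : ℕ∞) < G.egirth := lt_of_le_of_lt (by exact_mod_cast (by omega)) h
    have hadj : ∀ x ∈ (G.neighborFinset w).erase u, G.Adj w x := by simp
    calc ∑ i ∈ Finset.range (n + 1 + 1), (k - 1) ^ i
        = 1 + ∑ x ∈ (G.neighborFinset w).erase u, ∑ i ∈ Finset.range (n + 1), (k - 1) ^ i := by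
          rw [Finset.sum_const, Finset.card_erase_of_mem (by simpa using huw.symm),
            hG.card_neighborFinset, Finset.sum_range_succ', add_comm, smul_eq_mul, Finset.mul_sum]
          simp [pow_succ']
      _ ≤ 1 + ∑ x ∈ (G.neighborFinset w).erase u, (branch G n w x).card := by
          gcongr with x hx
          exact ih hn (hadj x hx)
      _ = _ := (one_add_sum_card_branch h hadj).symm
      _ ≤ _ := by
          refine Finset.card_le_card (Finset.insert_subset ?_ (Finset.biUnion_subset.2 ?_))
          · exact mem_branch.2 ⟨Walk.nil, by simp, by simpa using huw.ne, by simp⟩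
          · intro x hx
            exact branch_subset_branch_succ h huw.symm (hadj x hx) (Finset.ne_of_mem_erase hx)

open Classical in
/-- The vertices whose distance from `o` lies in the interval `[a, b)`. -/
noncomputable def distBand {V : Type*} [Fintype V] (G : SimpleGraph V) (o : V) (a b : ℤ) :
    Finset V :=
  {z | a ≤ G.dist o z ∧ (G.dist o z : ℤ) < b}

theorem mem_distBand {V : Type*} [Fintype V] {G : SimpleGraph V} {o z : V} {a b : ℤ} :
    z ∈ distBand G o a b ↔ a ≤ G.dist o z ∧ (G.dist o z : ℤ) < b := by
  simp [distBand]

theorem card_distBand_add_le {V : Type*} [Fintype V] (G : SimpleGraph V) (o : V) {a b c : ℤ}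
    (hab : a ≤ b) (hbc : b ≤ c) :
    (distBand G o a b).card + (distBand G o b c).card ≤ (distBand G o a c).card := by
  classical
  rw [← Finset.card_union_of_disjoint]
  · refine Finset.card_le_card fun z hz => ?_
    rw [Finset.mem_union] at hz
    simp only [mem_distBand] at hz ⊢
    omega
  · rw [Finset.disjoint_left]
    intro z h1 h2
    simp only [mem_distBand] at h1 h2
    omega

theorem branch_subset_distBand {V : Type*} [Fintype V] {G : SimpleGraph V} (hc : G.Connected)
    {n : ℕ} {o u w : V} {a b : ℤ} (ha : a + n ≤ G.dist o w) (hb : (G.dist o w : ℤ) + n < b) :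
    branch G n u w ⊆ distBand G o a b := by
  intro z hz
  obtain ⟨q, -, -, hq⟩ := mem_branch.1 hz
  have h1 := dist_le q
  have h2 := hc.dist_triangle (u := o) (v := w) (w := z)
  have h3 := hc.dist_triangle (u := o) (v := z) (w := w)
  rw [dist_comm (u := z)] at h3
  rw [mem_distBand]
  omega

theorem exists_adj_dist_eq {V : Type*} {G : SimpleGraph V} (hc : G.Connected) (o v : V) {i : ℕ}
    (hi : i < G.dist o v) : ∃ x y, G.Adj x y ∧ G.dist o x = i ∧ G.dist o y = i + 1 := by
  obtain ⟨p, hp⟩ := hc.exists_walk_length_eq_dist o v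
  have key : ∀ j ≤ p.length, G.dist o (p.getVert j) = j := by
    intro j hj
    have h1 := dist_le (p.take j)
    have h2 := dist_le (p.drop j)
    have h3 := hc.dist_triangle (u := o) (v := p.getVert j) (w := v)
    rw [Walk.take_length] at h1
    rw [Walk.drop_length] at h2
    omega
  exact ⟨p.getVert i, p.getVert (i + 1), p.adj_getVert_succ (by omega), key _ (by omega),
    key _ (by omega)⟩

theorem exists_vertex_dist_eq {V : Type*} {G : SimpleGraph V} (hc : G.Connected) (o v : V) {i : ℕ}
    (hi : i ≤ G.dist o v) : ∃ x, G.dist o x = i := by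
  rcases hi.lt_or_eq with hi | hi
  · obtain ⟨x, -, -, hx, -⟩ := exists_adj_dist_eq hc o v hi
    exact ⟨x, hx⟩
  · exact ⟨v, hi.symm⟩

/-- A band of `m` consecutive distances whose central one or two distances from `o` are attained
along a geodesic has at least Moore bound many vertices. -/
theorem mooreBound_le_card_distBand {k : ℕ} {V : Type*} [Fintype V] {G : SimpleGraph V}
    (hG : IsRegular' k G) (hc : G.Connected) {m : ℕ} (hm : (m : ℕ∞) ≤ G.egirth) (o v : V) {a : ℤ}
    (hlow : 0 < m → 0 ≤ a + (m - 1) / 2) (hhigh : 0 < m → a + m / 2 ≤ G.dist o v) :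
    mooreBound k m ≤ (distBand G o a (a + m)).card := by
  classical
  obtain ⟨n, rfl | rfl⟩ := m.even_or_odd'
  · obtain _ | n := n
    · simp [mooreBound]
    have hlow' := hlow (by omega)
    have hhigh' := hhigh (by omega)
    push_cast at hlow' hhigh'
    obtain ⟨i, hi⟩ := Int.eq_ofNat_of_zero_le (show 0 ≤ a + n by omega)
    obtain ⟨x, y, hxy, hx, hy⟩ := exists_adj_dist_eq hc o v (i := i) (by omega)
    have h1 : ((2 * n : ℕ) : ℕ∞) < G.egirth := lt_of_lt_of_le (by exact_mod_cast (by omega)) hm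
    have h2 : ((2 * n + 1 : ℕ) : ℕ∞) < G.egirth :=
      lt_of_lt_of_le (by exact_mod_cast (by omega)) hm
    calc mooreBound k ((2 * (n + 1) : ℕ) : ℤ)
        = ∑ i ∈ Finset.range (n + 1), (k - 1) ^ i + ∑ i ∈ Finset.range (n + 1), (k - 1) ^ i := by
          rw [mooreBound, if_neg (by omega), if_neg (by omega), two_mul]
          congr <;> omega
      _ ≤ (branch G n x y).card + (branch G n y x).card :=
          Nat.add_le_add (geom_sum_le_card_branch hG h1 hxy)
            (geom_sum_le_card_branch hG h1 hxy.symm)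
      _ = (branch G n x y ∪ branch G n y x).card :=
          (Finset.card_union_of_disjoint (disjoint_branch_swap h2 hxy)).symm
      _ ≤ _ := Finset.card_le_card (Finset.union_subset
          (branch_subset_distBand hc (by omega) (by push_cast; omega))
          (branch_subset_distBand hc (by omega) (by push_cast; omega)))
  · have hlow' := hlow (by omega)
    have hhigh' := hhigh (by omega)
    push_cast at hlow' hhigh'
    obtain ⟨i, hi⟩ := Int.eq_ofNat_of_zero_le (show 0 ≤ a + n by omega)
    obtain ⟨x, hx⟩ := exists_vertex_dist_eq hc o v (i := i) (by omega)
    have hxm : x ∈ distBand G o a (a + (2 * n + 1 : ℕ)) := by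
      rw [mem_distBand]; push_cast; omega
    obtain _ | n := n
    · simpa [mooreBound] using Finset.card_pos.2 ⟨x, hxm⟩
    have h1 : ((2 * n : ℕ) : ℕ∞) < G.egirth := lt_of_lt_of_le (by exact_mod_cast (by omega)) hm
    have h2 : ((2 * (n + 1) : ℕ) : ℕ∞) < G.egirth :=
      lt_of_lt_of_le (by exact_mod_cast (by omega)) hm
    have hadj : ∀ y ∈ G.neighborFinset x, G.Adj x y := by simp
    calc mooreBound k ((2 * (n + 1) + 1 : ℕ) : ℤ)
        = 1 + ∑ y ∈ G.neighborFinset x, ∑ i ∈ Finset.range (n + 1), (k - 1) ^ i := by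
          rw [mooreBound, if_neg (by omega), if_pos (by omega), Finset.sum_const,
            hG.card_neighborFinset, smul_eq_mul]
          congr; omega
      _ ≤ 1 + ∑ y ∈ G.neighborFinset x, (branch G n x y).card := by
          gcongr with y hy
          exact geom_sum_le_card_branch hG h1 (hadj y hy)
      _ = _ := (one_add_sum_card_branch h2 hadj).symm
      _ ≤ _ := by
          refine Finset.card_le_card (Finset.insert_subset hxm (Finset.biUnion_subset.2 ?_))
          intro y hy
          have hxy := hadj y hy
          have h3 := hc.dist_triangle (u := o) (v := x) (w := y)
          have h4 := hc.dist_triangle (u := o) (v := y) (w := x)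
          rw [dist_eq_one_iff_adj.2 hxy] at h3
          rw [dist_eq_one_iff_adj.2 hxy.symm] at h4
          exact branch_subset_distBand hc (by omega) (by push_cast; omega)

theorem mul_mooreBound_le_card_distBand {k : ℕ} {V : Type*} [Fintype V] {G : SimpleGraph V}
    (hG : IsRegular' k G) (hc : G.Connected) {g : ℕ} (hg0 : 0 < g) (hg : (g : ℕ∞) ≤ G.egirth)
    (o v : V) {a : ℤ} (hlow : 0 ≤ a + (g - 1) / 2) (r : ℕ)
    (hhigh : a + r * g + g / 2 ≤ G.dist o v) :
    (r + 1) * mooreBound k g ≤ (distBand G o a (a + (r + 1) * g)).card := by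
  induction r with
  | zero =>
    simpa using mooreBound_le_card_distBand hG hc hg o v (fun _ => hlow)
      (fun _ => by simpa using hhigh)
  | succ r ih =>
    have hrg : (0 : ℤ) ≤ r * g := by positivity
    push_cast [add_mul] at hhigh ih ⊢
    have h1 := ih (by omega)
    have h2 := mooreBound_le_card_distBand hG hc hg o v (a := a + (r * g + 1 * g))
      (fun _ => by omega) (fun _ => by omega)
    have h3 := card_distBand_add_le G o (a := a) (b := a + (r * g + 1 * g))
      (c := a + (r * g + 1 * g) + g) (by omega) (by omega)
    rw [show a + ((r : ℤ) * g + 1 * g + 1 * g) = a + (r * g + 1 * g) + g by ring]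
    omega

theorem moore_bound_large_diameter (k g d t r s : ℕ) (hk : 3 ≤ k) (hg : 3 ≤ g)
    (ht : t = g / 2) (hs : s ≤ g - 1) (hd : d = 2 * t + 1 + r * g + s)
    {V : Type*} [Fintype V] (G : SimpleGraph V) (hG : IsKGDGraph k g d G) :
    (r + 2) * mooreBound k g + mooreBound k s ≤ Fintype.card V := by
  obtain ⟨hreg, hgirth, hdiam⟩ := hG
  have hcyc : ¬ G.IsAcyclic := by
    rw [← egirth_eq_top, hgirth]
    exact ENat.natCast_ne_top g
  obtain ⟨x, -⟩ := exists_egirth_eq_length.2 hcyc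
  have : Nonempty V := ⟨x⟩
  have htop : G.ediam ≠ ⊤ := by
    rw [hdiam]
    exact ENat.natCast_ne_top d
  have hc := connected_of_ediam_ne_top htop
  obtain ⟨o, v, hov⟩ := exists_edist_eq_ediam_of_ne_top htop
  have hdist : G.dist o v = d := by
    rw [hdiam, ← (hc o v).coe_dist_eq_edist] at hov
    exact_mod_cast hov
  have hdz : (d : ℤ) = 2 * t + 1 + r * g + s := by exact_mod_cast hd
  have hrg : (0 : ℤ) ≤ r * g := by positivity
  have hsg : (s : ℕ∞) ≤ G.egirth := by
    rw [hgirth]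
    exact_mod_cast (by omega)
  let a : ℤ := -((g - 1) / 2)
  have h1 := mooreBound_le_card_distBand hreg hc hgirth.ge o v (a := a)
    (fun _ => by omega) (fun _ => by omega)
  have h2 := mooreBound_le_card_distBand hreg hc hsg o v (a := a + g)
    (fun _ => by omega) (fun _ => by omega)
  have h3 := mul_mooreBound_le_card_distBand hreg hc (by omega) hgirth.ge o v (a := a + g + s)
    (by omega) r (by omega)
  have h4 := card_distBand_add_le G o (a := a) (b := a + g) (c := a + g + s) (by omega) (by omega)
  have h5 := card_distBand_add_le G o (a := a) (b := a + g + s)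
    (c := a + g + s + (r + 1) * g) (by omega) (by nlinarith)
  have h6 := (distBand G o a (a + g + s + (r + 1) * g)).card_le_univ
  linarith
end

section
/- Let k ≥ 3 be an integer and let g = 2t ≥ 4 be an even integer, and let d be an integer with t ≤ d ≤ g. Then every finite k-regular simple graph with girth exactly g and diameter exactly d has at least M(k,g) + 2·max{M_0(k, 2d−2t−1), M_1(k, 2d−2t−1)} vertices. -/
/-- `M₀(k,m)` for odd `m = 2τ+1 ≥ 1` is `1 + k·∑_{i=0}^{⌊(τ−2)/2⌋}(k−1)^{2i+1}`,
with the convention `M₀(k,m) = 0` for `m ≤ 0`. -/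
def mooreBound0 (k : ℕ) (m : ℤ) : ℕ :=
  if m ≤ 0 then 0
  else 1 + k * ∑ i ∈ Finset.range (((m - 1) / 2 - 2) / 2 + 1).toNat, (k - 1) ^ (2 * i + 1)

/-- `M₁(k,m)` for odd `m = 2τ+1 ≥ 1` is `k·∑_{i=0}^{⌊(τ−1)/2⌋}(k−1)^{2i}`,
with the convention `M₁(k,m) = 0` for `m ≤ 0`. -/
def mooreBound1 (k : ℕ) (m : ℤ) : ℕ :=
  if m ≤ 0 then 0
  else k * ∑ i ∈ Finset.range (((m - 1) / 2 - 1) / 2 + 1).toNat, (k - 1) ^ (2 * i)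

open Finset

namespace SimpleGraph

/-- Two distinct paths with the same endpoints bound the girth by their total length. -/
theorem egirth_le_add_length_of_isPath_ne {V : Type*} {G : SimpleGraph V} {u v : V}
    {p q : G.Walk u v} (hp : p.IsPath) (hq : q.IsPath) (hne : p ≠ q) :
    G.egirth ≤ (p.length + q.length : ℕ) := by
  classical
  let S : Finset (Sym2 V) := p.edges.toFinset ∪ q.edges.toFinset
  let H : SimpleGraph V := fromEdgeSet (S : Set (Sym2 V))
  have hSG : ∀ e ∈ S, e ∈ G.edgeSet := by
    intro e he
    rcases Finset.mem_union.1 he with h | h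
    · exact p.edges_subset_edgeSet (List.mem_toFinset.1 h)
    · exact q.edges_subset_edgeSet (List.mem_toFinset.1 h)
  have hHS : ∀ e ∈ S, e ∈ H.edgeSet := by
    intro e he
    rw [edgeSet_fromEdgeSet]
    exact ⟨he, G.not_isDiag_of_mem_edgeSet (hSG e he)⟩
  have hSH : ∀ e ∈ H.edgeSet, e ∈ S := by
    intro e he
    rw [edgeSet_fromEdgeSet] at he
    exact he.1
  have hpH : ∀ e ∈ p.edges, e ∈ H.edgeSet := fun e he =>
    hHS e (Finset.mem_union_left _ (List.mem_toFinset.2 he))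
  have hqH : ∀ e ∈ q.edges, e ∈ H.edgeSet := fun e he =>
    hHS e (Finset.mem_union_right _ (List.mem_toFinset.2 he))
  have hcyc : ¬ H.IsAcyclic := by
    intro hac
    have h := congrArg Subtype.val
      ((hac.subsingleton_path u v).elim ⟨p.transfer H hpH, hp.transfer hpH⟩ ⟨q.transfer H hqH, hq.transfer hqH⟩)
    have h2 := congrArg Walk.support h
    simp only [Walk.support_transfer] at h2
    exact hne (Walk.ext_support h2)
  simp only [IsAcyclic, not_forall, not_not] at hcyc
  obtain ⟨a, c, hc⟩ := hcyc
  have hcS : c.edges.toFinset ⊆ S := fun e he =>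
    hSH e (c.edges_subset_edgeSet (List.mem_toFinset.1 he))
  have hcG : ∀ e ∈ c.edges, e ∈ G.edgeSet := fun e he =>
    hSG e (hcS (List.mem_toFinset.2 he))
  have hlen : c.length ≤ p.length + q.length := by
    calc c.length = c.edges.toFinset.card := by
          rw [List.toFinset_card_of_nodup hc.edges_nodup, Walk.length_edges]
      _ ≤ S.card := Finset.card_le_card hcS
      _ ≤ p.edges.toFinset.card + q.edges.toFinset.card := Finset.card_union_le _ _
      _ ≤ p.length + q.length := by
          rw [← Walk.length_edges p, ← Walk.length_edges q]
          exact Nat.add_le_add (List.toFinset_card_le _) (List.toFinset_card_le _)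
  have h := egirth_le_length (hc.transfer hcG)
  rw [Walk.length_transfer] at h
  exact h.trans (by exact_mod_cast hlen)

theorem notMem_support_of_length_eq_dist {V : Type*} {G : SimpleGraph V} {v x w : V}
    {p : G.Walk v x} (hp : p.length = G.dist v x) (hle : G.dist v x ≤ G.dist v w)
    (hne : w ≠ x) : w ∉ p.support := by
  classical
  intro hw
  have h1 := p.length_takeUntil_lt_length hw hne
  have h2 := dist_le (p.takeUntil w hw)
  omega

/-- Two distinct neighbours of `w` that are no farther than `w` from `v` close a short cycle. -/
theorem Connected.egirth_le_dist_add_dist {V : Type*} {G : SimpleGraph V} (hG : G.Connected)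
    {v w x y : V} (hx : G.Adj x w) (hy : G.Adj y w) (hxy : x ≠ y)
    (hxw : G.dist v x ≤ G.dist v w) (hyw : G.dist v y ≤ G.dist v w) :
    G.egirth ≤ (G.dist v x + G.dist v y + 2 : ℕ) := by
  obtain ⟨p, hp, hpl⟩ := hG.exists_path_of_dist v x
  obtain ⟨q, hq, hql⟩ := hG.exists_path_of_dist v y
  have hp' := hp.concat (notMem_support_of_length_eq_dist hpl hxw hx.ne') hx
  have hq' := hq.concat (notMem_support_of_length_eq_dist hql hyw hy.ne') hy
  have hne : p.concat hx ≠ q.concat hy := by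
    intro h
    have h' := congrArg Walk.penultimate h
    simp only [Walk.penultimate_concat] at h'
    exact hxy h'
  have h := egirth_le_add_length_of_isPath_ne hp' hq' hne
  rw [Walk.length_concat, Walk.length_concat, hpl, hql] at h
  exact h.trans (le_of_eq (by congr 1; omega))

theorem Connected.exists_adj_dist_add_one {V : Type*} {G : SimpleGraph V} (hG : G.Connected)
    {v w : V} (hne : v ≠ w) : ∃ y, G.Adj y w ∧ G.dist v y + 1 = G.dist v w := by
  obtain ⟨p, -, hpl⟩ := hG.exists_path_of_dist v w
  have hnil : ¬ p.Nil := fun h => hne h.eq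
  refine ⟨p.penultimate, p.adj_penultimate hnil, ?_⟩
  have h1 := dist_le p.dropLast
  have h2 := hG.dist_triangle (u := v) (v := p.penultimate) (w := w)
  have h3 : G.dist p.penultimate w = 1 := dist_eq_one_iff_adj.2 (p.adj_penultimate hnil)
  have h4 : p.dropLast.length + 1 = p.length := by
    have h := congrArg Walk.length (Walk.concat_dropLast (p.adj_penultimate hnil))
    rwa [Walk.length_concat] at h
  omega

theorem Connected.dist_ne_of_adj {V : Type*} {G : SimpleGraph V} (hG : G.Connected)
    {v w x : V} (hx : G.Adj x w) (hg : ((2 * G.dist v w + 1 : ℕ) : ℕ∞) < G.egirth) :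
    G.dist v x ≠ G.dist v w := by
  intro h
  have hvw : v ≠ w := by
    rintro rfl
    rw [dist_self, hG.dist_eq_zero_iff] at h
    exact hx.ne h.symm
  obtain ⟨y, hy, hyd⟩ := hG.exists_adj_dist_add_one hvw
  have hle := hG.egirth_le_dist_add_dist hx hy (by rintro rfl; omega) h.le (by omega)
  have := hg.trans_le hle
  rw [Nat.cast_lt] at this
  omega

variable {V : Type*} [Fintype V]

open Classical in
/-- The vertices at distance exactly `j` from `v`. -/
noncomputable def distSphere (G : SimpleGraph V) (v : V) (j : ℕ) : Finset V :=
  univ.filter fun w => G.dist v w = j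

open Classical in
/-- The vertices at distance at most `r` from `v` whose distance has the parity of `r`. -/
noncomputable def parityBall (G : SimpleGraph V) (v : V) (r : ℕ) : Finset V :=
  univ.filter fun w => G.dist v w ≤ r ∧ G.dist v w % 2 = r % 2

variable {G : SimpleGraph V} {k : ℕ}

theorem mem_distSphere {v w : V} {j : ℕ} : w ∈ G.distSphere v j ↔ G.dist v w = j := by
  simp [distSphere]

theorem mem_parityBall {v w : V} {r : ℕ} :
    w ∈ G.parityBall v r ↔ G.dist v w ≤ r ∧ G.dist v w % 2 = r % 2 := by
  simp [parityBall]

open Classical in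
theorem card_filter_adj (hG : IsRegular' k G) (v : V) : #{w | G.Adj v w} = k := by
  rw [← hG v, ← Set.ncard_coe_finset]
  congr 1
  ext w
  simp

open Classical in
/-- In a regular graph of positive degree, an independent set has at most half the vertices. -/
theorem two_mul_card_le_of_independent (hG : IsRegular' k G) (hk : 0 < k) (I : Finset V)
    (hI : ∀ x ∈ I, ∀ y ∈ I, ¬ G.Adj x y) : 2 * #I ≤ Fintype.card V := by
  have h : #I * k ≤ #Iᶜ * k := by
    refine card_mul_le_card_mul G.Adj ?_ ?_
    · intro a ha
      rw [← card_filter_adj hG a]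
      refine card_le_card fun b hb => ?_
      rw [mem_filter_univ] at hb
      simp only [bipartiteAbove, mem_filter, mem_compl]
      exact ⟨fun hbI => hI a ha b hbI hb, hb⟩
    · intro b _
      rw [← card_filter_adj hG b]
      refine card_le_card fun a ha => ?_
      simp only [bipartiteBelow, mem_filter] at ha
      rw [mem_filter_univ]
      exact ha.2.symm
  have h1 := Nat.le_of_mul_le_mul_right h hk
  have h2 := card_add_card_compl I
  omega

open Classical in
theorem mul_pow_le_card_distSphere (hreg : IsRegular' k G) (hG : G.Connected) (v : V) (j : ℕ)
    (hg : ((2 * j + 2 : ℕ) : ℕ∞) < G.egirth) :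
    k * (k - 1) ^ j ≤ #(G.distSphere v (j + 1)) := by
  induction j with
  | zero =>
    rw [pow_zero, mul_one, ← card_filter_adj hreg v]
    refine card_le_card fun w hw => ?_
    rw [mem_filter_univ] at hw
    rw [mem_distSphere, zero_add]
    exact dist_eq_one_iff_adj.2 hw
  | succ j ih =>
    have ih := ih (lt_of_le_of_lt (by exact_mod_cast (by omega)) hg)
    have h : #(G.distSphere v (j + 1)) * (k - 1) ≤ #(G.distSphere v (j + 1 + 1)) * 1 := by
      refine card_mul_le_card_mul G.Adj ?_ ?_
      · intro a ha
        rw [mem_distSphere] at ha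
        have hsplit : ({w | G.Adj a w} : Finset V) ⊆
            (G.distSphere v (j + 1 + 1)).bipartiteAbove G.Adj a ∪
              ({w | G.Adj a w ∧ G.dist v w ≤ j + 1} : Finset V) := by
          intro w hw
          rw [mem_filter_univ] at hw
          have h1 := hG.dist_triangle (u := v) (v := a) (w := w)
          have h2 : G.dist a w = 1 := dist_eq_one_iff_adj.2 hw
          simp only [bipartiteAbove, mem_union, mem_filter, mem_distSphere, mem_univ, true_and, hw,
            and_true]
          omega
        have hone : #{w | G.Adj a w ∧ G.dist v w ≤ j + 1} ≤ 1 := by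
          rw [card_le_one]
          intro x hx y hy
          rw [mem_filter_univ] at hx hy
          by_contra hxy
          have hle := hG.egirth_le_dist_add_dist (v := v) hx.1.symm hy.1.symm hxy
            (by omega) (by omega)
          have := hg.trans_le hle
          rw [Nat.cast_lt] at this
          omega
        have h1 := (card_le_card hsplit).trans (card_union_le _ _)
        rw [card_filter_adj hreg a] at h1
        omega
      · intro b hb
        rw [mem_distSphere] at hb
        rw [card_le_one]
        intro x hx y hy
        simp only [bipartiteBelow, mem_filter, mem_distSphere] at hx hy
        by_contra hxy
        have hle := hG.egirth_le_dist_add_dist (v := v) hx.2 hy.2 hxy (by omega) (by omega)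
        have := hg.trans_le hle
        rw [Nat.cast_lt] at this
        omega
    calc k * (k - 1) ^ (j + 1) = k * (k - 1) ^ j * (k - 1) := by rw [pow_succ, mul_assoc]
      _ ≤ #(G.distSphere v (j + 1)) * (k - 1) := Nat.mul_le_mul_right _ ih
      _ ≤ #(G.distSphere v (j + 1 + 1)) := by rwa [mul_one] at h

theorem sum_pow_le_card_parityBall (hk : 1 ≤ k) (hreg : IsRegular' k G) (hG : G.Connected)
    (v : V) : ∀ r : ℕ, ((2 * r : ℕ) : ℕ∞) < G.egirth →
      ∑ i ∈ range (r + 1), (k - 1) ^ i ≤ #(G.parityBall v r)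
  | 0, _ => by
    have hv : v ∈ G.parityBall v 0 := by simp [mem_parityBall]
    simpa using card_pos.2 ⟨v, hv⟩
  | 1, hg => by
    have h := mul_pow_le_card_distSphere hreg hG v 0 hg
    have hsub : G.distSphere v (0 + 1) ⊆ G.parityBall v 1 := by
      intro w hw
      rw [mem_distSphere] at hw
      rw [mem_parityBall]
      omega
    have h2 := h.trans (card_le_card hsub)
    simp only [sum_range_succ, range_zero, sum_empty, pow_zero, pow_one] at h2 ⊢
    omega
  | r + 2, hg => by
    classical
    have ih := sum_pow_le_card_parityBall hk hreg hG v r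
      (lt_of_le_of_lt (by exact_mod_cast (by omega)) hg)
    have hs := mul_pow_le_card_distSphere hreg hG v (r + 1) hg
    have hdisj : Disjoint (G.parityBall v r) (G.distSphere v (r + 1 + 1)) := by
      rw [Finset.disjoint_left]
      intro w hw hw'
      rw [mem_parityBall] at hw
      rw [mem_distSphere] at hw'
      omega
    have hsub : G.parityBall v r ∪ G.distSphere v (r + 1 + 1) ⊆ G.parityBall v (r + 2) := by
      intro w hw
      rw [mem_union, mem_parityBall, mem_distSphere] at hw
      rw [mem_parityBall]
      omega
    have hcard := card_le_card hsub
    rw [card_union_of_disjoint hdisj] at hcard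
    have hpow : k * (k - 1) ^ (r + 1) = (k - 1) ^ (r + 2) + (k - 1) ^ (r + 1) := by
      obtain ⟨q, rfl⟩ : ∃ q, k = q + 1 := ⟨k - 1, by omega⟩
      rw [Nat.add_sub_cancel]
      ring
    rw [sum_range_succ, sum_range_succ]
    omega

theorem Connected.not_adj_of_mem_parityBall (hG : G.Connected) {v x y : V} {r : ℕ}
    (hg : ((2 * r + 1 : ℕ) : ℕ∞) < G.egirth) (hx : x ∈ G.parityBall v r)
    (hy : y ∈ G.parityBall v r) : ¬ G.Adj x y := by
  intro h
  rw [mem_parityBall] at hx hy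
  have h1 := hG.dist_triangle (u := v) (v := x) (w := y)
  have h2 := hG.dist_triangle (u := v) (v := y) (w := x)
  have h3 : G.dist x y = 1 := dist_eq_one_iff_adj.2 h
  have h4 : G.dist y x = 1 := dist_eq_one_iff_adj.2 h.symm
  refine hG.dist_ne_of_adj h (v := v) (lt_of_le_of_lt ?_ hg) (by omega)
  exact_mod_cast (by omega)

end SimpleGraph

theorem one_add_mul_sum_pow_odd (q n : ℕ) :
    1 + (q + 1) * ∑ i ∈ range n, q ^ (2 * i + 1) = ∑ i ∈ range (2 * n + 1), q ^ i := by
  induction n with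
  | zero => simp
  | succ n ih =>
    rw [sum_range_succ, show 2 * (n + 1) + 1 = 2 * n + 1 + 1 + 1 by ring, sum_range_succ,
      sum_range_succ, ← ih]
    ring

theorem mul_sum_pow_even (q n : ℕ) :
    (q + 1) * ∑ i ∈ range n, q ^ (2 * i) = ∑ i ∈ range (2 * n), q ^ i := by
  induction n with
  | zero => simp
  | succ n ih =>
    rw [sum_range_succ, show 2 * (n + 1) = 2 * n + 1 + 1 by ring, sum_range_succ,
      sum_range_succ, ← ih]
    ring

theorem mooreBound0_le_sum_pow {k : ℕ} (hk : 1 ≤ k) (s : ℕ) :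
    mooreBound0 k (2 * (s : ℤ) - 1) ≤ ∑ i ∈ range s, (k - 1) ^ i := by
  obtain ⟨q, rfl⟩ : ∃ q, k = q + 1 := ⟨k - 1, by omega⟩
  unfold mooreBound0
  split_ifs with h
  · exact Nat.zero_le _
  · rw [Nat.add_sub_cancel, one_add_mul_sum_pow_odd]
    refine sum_le_sum_of_subset (range_mono ?_)
    omega

theorem mooreBound1_le_sum_pow {k : ℕ} (hk : 1 ≤ k) (s : ℕ) :
    mooreBound1 k (2 * (s : ℤ) - 1) ≤ ∑ i ∈ range s, (k - 1) ^ i := by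
  obtain ⟨q, rfl⟩ : ∃ q, k = q + 1 := ⟨k - 1, by omega⟩
  unfold mooreBound1
  split_ifs with h
  · exact Nat.zero_le _
  · rw [Nat.add_sub_cancel, mul_sum_pow_even]
    refine sum_le_sum_of_subset (range_mono ?_)
    omega

theorem mooreBound_two_mul (k t : ℕ) :
    mooreBound k ((2 * t : ℕ) : ℤ) = 2 * ∑ i ∈ range t, (k - 1) ^ i := by
  unfold mooreBound
  split_ifs with h1 h2
  · obtain rfl : t = 0 := by omega
    simp
  · omega
  · congr 3
    omega

namespace SimpleGraph

variable {V : Type*} [Fintype V] {G : SimpleGraph V} {k : ℕ}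

/-- Parity balls of radii `a` and `b` around vertices at distance more than `a + b + 1` form an
independent set together, which has at most half the vertices. -/
theorem two_mul_card_parityBall_add_le (hk : 0 < k) (hreg : IsRegular' k G) (hG : G.Connected)
    {u v : V} {a b : ℕ} (hd : a + b + 1 < G.dist u v)
    (ha : ((2 * a + 1 : ℕ) : ℕ∞) < G.egirth) (hb : ((2 * b + 1 : ℕ) : ℕ∞) < G.egirth) :
    2 * (#(G.parityBall u a) + #(G.parityBall v b)) ≤ Fintype.card V := by
  classical
  have hfar : ∀ x ∈ G.parityBall u a, ∀ y ∈ G.parityBall v b, 1 < G.dist x y := by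
    intro x hx y hy
    rw [mem_parityBall] at hx hy
    have h1 := hG.dist_triangle (u := u) (v := x) (w := v)
    have h2 := hG.dist_triangle (u := x) (v := y) (w := v)
    rw [dist_comm (u := y)] at h2
    omega
  have hnadj : ∀ x ∈ G.parityBall u a, ∀ y ∈ G.parityBall v b, ¬ G.Adj x y := by
    intro x hx y hy h
    have h1 := hfar x hx y hy
    rw [dist_eq_one_iff_adj.2 h] at h1
    omega
  have hdisj : Disjoint (G.parityBall u a) (G.parityBall v b) := by
    rw [Finset.disjoint_left]
    intro x hx hx'
    have h1 := hfar x hx x hx'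
    rw [dist_self] at h1
    omega
  rw [← card_union_of_disjoint hdisj]
  refine two_mul_card_le_of_independent hreg hk _ fun x hx y hy => ?_
  rcases mem_union.1 hx with hx | hx <;> rcases mem_union.1 hy with hy | hy
  · exact hG.not_adj_of_mem_parityBall ha hx hy
  · exact hnadj x hx y hy
  · exact fun h => hnadj y hy x hx h.symm
  · exact hG.not_adj_of_mem_parityBall hb hx hy

end SimpleGraph

open SimpleGraph in
theorem improved_moore_bound_even_girth (k g d t : ℕ) (hk : 3 ≤ k)
    (ht : g = 2 * t) (hg : 4 ≤ g) (hd1 : t ≤ d) (hd2 : d ≤ g)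
    {V : Type*} [Fintype V] (G : SimpleGraph V) (hG : IsKGDGraph k g d G) :
    mooreBound k g +
      2 * max (mooreBound0 k (2 * (d : ℤ) - 2 * t - 1))
        (mooreBound1 k (2 * (d : ℤ) - 2 * t - 1)) ≤ Fintype.card V := by
  obtain ⟨hreg, hgirth, hdiam⟩ := hG
  have hnt : Nontrivial V := G.nontrivial_of_ediam_ne_zero (by
    rw [hdiam]
    exact_mod_cast (by omega))
  have hconn : G.Connected := connected_of_ediam_ne_top (by simp [hdiam])
  obtain ⟨u, v, huv⟩ := G.exists_edist_eq_ediam_of_finite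
  have hdist : G.dist u v = d := by
    rw [hdiam, ← (hconn u v).coe_dist_eq_edist] at huv
    exact_mod_cast huv
  obtain ⟨s, rfl⟩ := Nat.exists_eq_add_of_le hd1
  have hm : 2 * ((t + s : ℕ) : ℤ) - 2 * t - 1 = 2 * (s : ℤ) - 1 := by push_cast; ring
  have hmax : max (mooreBound0 k (2 * (s : ℤ) - 1)) (mooreBound1 k (2 * (s : ℤ) - 1)) ≤
      ∑ i ∈ range s, (k - 1) ^ i :=
    max_le (mooreBound0_le_sum_pow (by omega) s) (mooreBound1_le_sum_pow (by omega) s)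
  rw [hm, ht, mooreBound_two_mul]
  have hball : ∀ (w : V) (r : ℕ), r + 1 ≤ t →
      ∑ i ∈ range (r + 1), (k - 1) ^ i ≤ #(G.parityBall w r) := fun w r hr =>
    sum_pow_le_card_parityBall (by omega) hreg hconn w r (by
      rw [hgirth]
      exact_mod_cast (by omega))
  have hlt : ∀ r : ℕ, r + 1 ≤ t → ((2 * r + 1 : ℕ) : ℕ∞) < G.egirth := by
    intro r hr
    rw [hgirth]
    exact_mod_cast (by omega)
  obtain ⟨a, rfl⟩ : ∃ a, t = a + 1 := ⟨t - 1, by omega⟩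
  have hu := hball u a le_rfl
  rcases s with _ | b
  · rw [range_zero, sum_empty] at hmax
    have h := two_mul_card_le_of_independent hreg (by omega) (G.parityBall u a)
      fun x hx y hy => hconn.not_adj_of_mem_parityBall (hlt a le_rfl) hx hy
    omega
  · have hv := hball v b (by omega)
    have h := two_mul_card_parityBall_add_le (u := u) (v := v) (a := a) (b := b) (by omega)
      hreg hconn (by omega) (hlt a le_rfl) (hlt b (by omega))
    omega
end

section
/- For all integers k ≥ 3 and g ≥ 3, f(k,g) ≥ M(k,g)/g. -/
/-- `f(k,g)`: the infimum of all real `c` for which there is a constant `C` such that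
for every sufficiently large `d` there is a `(k; g, d)`-graph with at most `c·d + C`
vertices. -/
noncomputable def fRatio (k g : ℕ) : ℝ :=
  sInf {c : ℝ | ∃ C : ℝ, ∃ d₀ : ℕ, ∀ d : ℕ, d₀ ≤ d →
    ∃ n : ℕ, (n : ℝ) ≤ c * d + C ∧ ∃ G : SimpleGraph (Fin n), IsKGDGraph k g d G}

namespace SimpleGraph

section Walks

variable {V W : Type*}

theorem Walk.exists_length_le_of_weakHom {G : SimpleGraph V} {H : SimpleGraph W} {f : V → W}
    (hf : ∀ x y, G.Adj x y → f x = f y ∨ H.Adj (f x) (f y)) {x y : V} (p : G.Walk x y) :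
    ∃ q : H.Walk (f x) (f y), q.length ≤ p.length := by
  induction p with
  | nil => exact ⟨.nil, le_rfl⟩
  | cons h p ih =>
    obtain ⟨q, hq⟩ := ih
    rcases hf _ _ h with e | e
    · exact ⟨q.copy e.symm rfl, by simp; omega⟩
    · exact ⟨.cons e q, by simp; omega⟩

theorem Walk.le_add_length_of_lipschitz {G : SimpleGraph V} {f : V → ℕ}
    (hf : ∀ x y, G.Adj x y → f y ≤ f x + 1) {x y : V} (p : G.Walk x y) :
    f y ≤ f x + p.length := by
  induction p with
  | nil => simp
  | cons h p ih =>
    have := hf _ _ h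
    simp only [Walk.length_cons]
    omega

theorem Walk.split_of_sup_edge {H : SimpleGraph V} {x y z v : V} (p : (H ⊔ edge x y).Walk z v) :
    (∃ q : H.Walk z v, q.length ≤ p.length) ∨
    (∃ (q₁ : H.Walk z x) (q₂ : H.Walk y v), q₁.length + 1 + q₂.length ≤ p.length) ∨
    (∃ (q₁ : H.Walk z y) (q₂ : H.Walk x v), q₁.length + 1 + q₂.length ≤ p.length) := by
  induction p with
  | nil => exact .inl ⟨.nil, le_rfl⟩
  | cons h p ih =>
    rw [sup_adj, edge_adj] at h
    rcases h with h | ⟨⟨rfl, rfl⟩ | ⟨rfl, rfl⟩, -⟩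
    · rcases ih with ⟨q, hq⟩ | ⟨q₁, q₂, hq⟩ | ⟨q₁, q₂, hq⟩
      · exact .inl ⟨.cons h q, by simpa using hq⟩
      · exact .inr (.inl ⟨.cons h q₁, q₂, by simp; omega⟩)
      · exact .inr (.inr ⟨.cons h q₁, q₂, by simp; omega⟩)
    · rcases ih with ⟨q, hq⟩ | ⟨q₁, q₂, hq⟩ | ⟨q₁, q₂, hq⟩
      · exact .inr (.inl ⟨.nil, q, by simp; omega⟩)
      · exact .inr (.inl ⟨.nil, q₂, by simp; omega⟩)
      · exact .inl ⟨q₂, by simp; omega⟩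
    · rcases ih with ⟨q, hq⟩ | ⟨q₁, q₂, hq⟩ | ⟨q₁, q₂, hq⟩
      · exact .inr (.inr ⟨.nil, q, by simp; omega⟩)
      · exact .inl ⟨q₂, by simp; omega⟩
      · exact .inr (.inr ⟨.nil, q₂, by simp; omega⟩)

theorem Walk.exists_length_le_of_le {G H : SimpleGraph V} (h : G ≤ H) {x y : V}
    (p : G.Walk x y) : ∃ q : H.Walk x y, q.length ≤ p.length :=
  ⟨p.mapLe h, by simp⟩

theorem natCast_le_egirth_iff {G : SimpleGraph V} {g : ℕ} :
    (g : ℕ∞) ≤ G.egirth ↔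
      ∀ x y, G.Adj x y → ∀ p : (G.deleteEdges {s(x, y)}).Walk x y, g ≤ p.length + 1 := by
  classical
  rw [le_egirth]
  constructor
  · intro h x y hxy p
    have hp : (p.bypass.mapLe (deleteEdges_le {s(x, y)})).IsPath :=
      (Walk.bypass_isPath p).mapLe _
    have hc : (Walk.cons hxy.symm (p.bypass.mapLe (deleteEdges_le {s(x, y)}))).IsCycle := by
      rw [Walk.cons_isCycle_iff]
      refine ⟨hp, fun hmem => ?_⟩
      rw [Walk.edges_mapLe_eq_edges] at hmem
      have := Walk.edges_subset_edgeSet _ hmem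
      simp [Sym2.eq_swap] at this
    have h1 := h _ _ hc
    have h2 := p.length_bypass_le_length
    simp only [Walk.length_cons, Walk.length_map, Walk.mapLe] at h1
    have h3 : g ≤ p.bypass.length + 1 := by exact_mod_cast h1
    omega
  · intro h a w hw
    cases w with
    | nil => simp at hw
    | @cons _ b _ hab p =>
      rw [Walk.cons_isCycle_iff] at hw
      have := h b a hab.symm (p.toDeleteEdge s(b, a) (by rw [Sym2.eq_swap]; exact hw.2))
      simp [Walk.toDeleteEdge, Walk.toDeleteEdges] at this
      simpa using (by exact_mod_cast this : (g : ℕ∞) ≤ p.length + 1)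

theorem le_egirth_sup_edge {G : SimpleGraph V} {g : ℕ} {x y : V} (hG : (g : ℕ∞) ≤ G.egirth)
    (hxy : ∀ p : G.Walk x y, g ≤ p.length + 1) : (g : ℕ∞) ≤ (G ⊔ edge x y).egirth := by
  have hyx : ∀ p : G.Walk y x, g ≤ p.length + 1 := fun p => by simpa using hxy p.reverse
  rw [natCast_le_egirth_iff] at hG ⊢
  intro u v huv p
  by_cases he : s(u, v) = s(x, y)
  · have hle : (G ⊔ edge x y).deleteEdges {s(u, v)} ≤ G := by
      intro a b hab
      rw [deleteEdges_adj, sup_adj, adj_edge, he] at hab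
      rcases hab with ⟨h | h, h'⟩
      · exact h
      · exact absurd h.1.symm h'
    obtain ⟨q, hq⟩ := p.exists_length_le_of_le hle
    rcases Sym2.eq_iff.1 he with ⟨rfl, rfl⟩ | ⟨rfl, rfl⟩
    · exact (hxy q).trans (by omega)
    · exact (hyx q).trans (by omega)
  · have huv' : G.Adj u v := by
      rw [sup_adj, adj_edge] at huv
      rcases huv with h | h
      · exact h
      · exact absurd h.1.symm he
    have hle : (G ⊔ edge x y).deleteEdges {s(u, v)} ≤ G.deleteEdges {s(u, v)} ⊔ edge x y := by
      intro a b hab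
      rw [deleteEdges_adj, sup_adj] at hab
      rw [sup_adj, deleteEdges_adj]
      tauto
    obtain ⟨q, hq⟩ := p.exists_length_le_of_le hle
    have hd : G.deleteEdges {s(u, v)} ≤ G := deleteEdges_le _
    rcases q.split_of_sup_edge with ⟨r, hr⟩ | ⟨q₁, q₂, hr⟩ | ⟨q₁, q₂, hr⟩
    · have := hG u v huv' r
      omega
    · have := hxy ((q₁.reverse.mapLe hd).append (.cons huv' (q₂.reverse.mapLe hd)))
      simp at this
      omega
    · have := hyx ((q₁.reverse.mapLe hd).append (.cons huv' (q₂.reverse.mapLe hd)))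
      simp at this
      omega

end Walks

section Extremal

variable {V : Type*}

theorem ncard_neighborSet_sup_edge [Finite V] {G : SimpleGraph V} {x y : V} (hne : x ≠ y)
    (hxy : ¬ G.Adj x y) (v : V) [Decidable (v = x)] [Decidable (v = y)] :
    ((G ⊔ edge x y).neighborSet v).ncard =
      (G.neighborSet v).ncard + (if v = x then 1 else 0) + (if v = y then 1 else 0) := by
  by_cases hx : v = x
  · subst hx
    have : (G ⊔ edge v y).neighborSet v = insert y (G.neighborSet v) := by
      ext w
      simp only [mem_neighborSet, sup_adj, edge_adj, Set.mem_insert_iff]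
      grind
    rw [this, Set.ncard_insert_of_notMem (by simpa using hxy)]
    simp [hne]
  · by_cases hy : v = y
    · subst hy
      have : (G ⊔ edge x v).neighborSet v = insert x (G.neighborSet v) := by
        ext w
        simp only [mem_neighborSet, sup_adj, edge_adj, Set.mem_insert_iff]
        grind
      rw [this, Set.ncard_insert_of_notMem (by simpa [adj_comm] using hxy)]
      simp [hx]
    · have : (G ⊔ edge x y).neighborSet v = G.neighborSet v := by
        ext w
        simp only [mem_neighborSet, sup_adj, edge_adj]
        grind
      simp [this, hx, hy]

theorem ncard_neighborSet_deleteEdges [Finite V] {G : SimpleGraph V} {x y : V}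
    (hxy : G.Adj x y) (v : V) [Decidable (v = x)] [Decidable (v = y)] :
    (G.neighborSet v).ncard = ((G.deleteEdges {s(x, y)}).neighborSet v).ncard +
      (if v = x then 1 else 0) + (if v = y then 1 else 0) := by
  rw [← ncard_neighborSet_sup_edge hxy.ne (by simp)]
  congr 2
  ext a b
  simp only [sup_adj, deleteEdges_adj, adj_edge, Set.mem_singleton_iff]
  constructor
  · intro h
    by_cases e : s(a, b) = s(x, y)
    · exact .inr ⟨e.symm, h.ne⟩
    · exact .inl ⟨h, e⟩
  · rintro (h | ⟨h, -⟩)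
    · exact h.1
    · rcases Sym2.eq_iff.1 h with ⟨rfl, rfl⟩ | ⟨rfl, rfl⟩
      · exact hxy
      · exact hxy.symm

theorem even_sum_ncard_neighborSet [Fintype V] (G : SimpleGraph V) :
    Even (∑ v, (G.neighborSet v).ncard) := by
  classical
  have : ∑ v, (G.neighborSet v).ncard = ∑ v, G.degree v := by
    refine Finset.sum_congr rfl fun v _ => ?_
    rw [Set.ncard_eq_toFinset_card', ← card_neighborFinset_eq_degree, neighborFinset]
  rw [this, sum_degrees_eq_twice_card_edges]
  exact even_two_mul _

theorem ncard_le_of_walk_length_le [Finite V] {G : SimpleGraph V} {k : ℕ}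
    (hk : ∀ v, (G.neighborSet v).ncard ≤ k) (S : Set V) (r : ℕ) :
    {w | ∃ s ∈ S, ∃ p : G.Walk s w, p.length ≤ r}.ncard ≤ S.ncard * (k + 1) ^ r := by
  classical
  have := Fintype.ofFinite V
  induction r with
  | zero =>
    rw [pow_zero, mul_one]
    refine Set.ncard_le_ncard ?_ (Set.toFinite _)
    rintro w ⟨s, hs, p, hp⟩
    rwa [← p.eq_of_length_eq_zero (by omega)]
  | succ r ih =>
    set B := {w | ∃ s ∈ S, ∃ p : G.Walk s w, p.length ≤ r} with hB
    have hsub : {w | ∃ s ∈ S, ∃ p : G.Walk s w, p.length ≤ r + 1} ⊆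
        (B.toFinset.biUnion fun v => insert v (G.neighborSet v).toFinset : Finset V) := by
      rintro w ⟨s, hs, p, hp⟩
      simp only [Finset.coe_biUnion, Set.mem_iUnion, Finset.mem_coe, Set.mem_toFinset,
        Finset.mem_insert, mem_neighborSet]
      by_cases hl : p.length ≤ r
      · exact ⟨w, ⟨s, hs, p, hl⟩, .inl rfl⟩
      · have hnil : ¬ p.Nil := by
          rw [← Walk.length_eq_zero_iff]; omega
        exact ⟨p.penultimate, ⟨s, hs, p.dropLast, by rw [Walk.length_dropLast]; omega⟩,
          .inr (p.adj_penultimate hnil)⟩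
    refine (Set.ncard_le_ncard hsub (Set.toFinite _)).trans ?_
    rw [Set.ncard_coe_finset]
    refine (Finset.card_biUnion_le_card_mul _ _ (k + 1) fun v _ => ?_).trans ?_
    · refine (Finset.card_insert_le _ _).trans ?_
      rw [← Set.ncard_eq_toFinset_card']
      exact Nat.succ_le_succ (hk v)
    · rw [← Set.ncard_eq_toFinset_card', pow_succ, ← mul_assoc]
      exact Nat.mul_le_mul_right _ ih

/-- One augmentation step of the Erdős–Sachs argument: far away from `x`, `y` and `F` one finds
either a deficient vertex to join to `x`, or an edge to break up and reconnect to `x` and `y`. -/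
theorem exists_augmentation [Fintype V] [DecidableEq V] {F G : SimpleGraph V} {g k : ℕ}
    {δ : V → ℕ} (hg : 3 ≤ g) (hFG : F ≤ G) (hG : (g : ℕ∞) ≤ G.egirth) (hδk : ∀ v, δ v ≤ k)
    (hδ : ∀ v, 1 ≤ δ v) {S : Set V} (hFS : ∀ v w, F.Adj v w → v ∈ S)
    (hcard : (S.ncard + 2) * (k + 1) ^ g < Fintype.card V) {x y : V}
    (hdeg : ∀ w, (G.neighborSet w).ncard + (if w = x then 1 else 0) + (if w = y then 1 else 0)
      ≤ δ w) :
    ∃ G' : SimpleGraph V, F ≤ G' ∧ (g : ℕ∞) ≤ G'.egirth ∧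
      (∀ w, (G'.neighborSet w).ncard ≤ δ w) ∧
      ∑ w, (G.neighborSet w).ncard < ∑ w, (G'.neighborSet w).ncard := by
  have hdeg' : ∀ w, (G.neighborSet w).ncard ≤ δ w := fun w => by have := hdeg w; omega
  obtain ⟨w, hw⟩ : ∃ w, w ∉ {w | ∃ s ∈ insert x (insert y S), ∃ p : G.Walk s w, p.length ≤ g} := by
    by_contra! h
    have h1 := ncard_le_of_walk_length_le (fun v => (hdeg' v).trans (hδk v))
      (insert x (insert y S)) g
    rw [Set.eq_univ_of_forall h, Set.ncard_univ, Nat.card_eq_fintype_card] at h1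
    have h2 : (insert x (insert y S)).ncard ≤ S.ncard + 2 :=
      (Set.ncard_insert_le _ _).trans (Nat.succ_le_succ (Set.ncard_insert_le _ _))
    have := Nat.mul_le_mul_right ((k + 1) ^ g) h2
    omega
  have hfar : ∀ s ∈ insert x (insert y S), ∀ p : G.Walk s w, g < p.length := by
    intro s hs p
    by_contra! h
    exact hw ⟨s, hs, p, h⟩
  have hxw : ∀ p : G.Walk x w, g < p.length := hfar x (by simp)
  have hyw : ∀ p : G.Walk y w, g < p.length := hfar y (by simp)
  have ne_of : ∀ {H : SimpleGraph V} {a b : V}, (∀ p : H.Walk a b, g ≤ p.length + 1) → a ≠ b := by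
    rintro H a b h rfl
    have := h .nil
    simp at this
    omega
  have nadj_of : ∀ {H : SimpleGraph V} {a b : V}, (∀ p : H.Walk a b, g ≤ p.length + 1) →
      ¬ H.Adj a b := by
    intro H a b h hab
    have := h (.cons hab .nil)
    simp at this
    omega
  by_cases hwδ : (G.neighborSet w).ncard < δ w
  · have hxw1 : ∀ p : G.Walk x w, g ≤ p.length + 1 := fun p => by have := hxw p; omega
    have hd := ncard_neighborSet_sup_edge (ne_of hxw1) (nadj_of hxw1)
    refine ⟨G ⊔ edge x w, hFG.trans le_sup_left, le_egirth_sup_edge hG hxw1, fun v => ?_, ?_⟩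
    · have h1 := hdeg v
      rw [hd v]
      by_cases hvw : v = w
      · subst hvw
        simp [(ne_of hxw1).symm]
        omega
      · simp only [hvw, if_false]
        omega
    · refine Finset.sum_lt_sum (fun v _ => by rw [hd v]; omega) ⟨x, Finset.mem_univ _, ?_⟩
      rw [hd x, if_pos rfl]
      omega
  · obtain ⟨u, hu⟩ : (G.neighborSet w).Nonempty := by
      rw [← Set.ncard_pos (Set.toFinite _)]
      have := hδ w
      omega
    rw [mem_neighborSet] at hu
    have hxu : ∀ p : G.Walk x u, g ≤ p.length := fun p => by
      have := hxw (p.concat hu.symm)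
      rw [Walk.length_concat] at this
      omega
    have hyu : ∀ p : G.Walk y u, g ≤ p.length := fun p => by
      have := hyw (p.concat hu.symm)
      rw [Walk.length_concat] at this
      omega
    have hle : G.deleteEdges {s(w, u)} ≤ G := deleteEdges_le _
    have hlift : ∀ {a b : V} {n : ℕ}, (∀ p : G.Walk a b, n ≤ p.length) →
        ∀ p : (G.deleteEdges {s(w, u)}).Walk a b, n ≤ p.length := fun h p => by
      simpa using h (p.mapLe hle)
    have hwu := natCast_le_egirth_iff.1 hG w u hu
    have h1 : (g : ℕ∞) ≤ (G.deleteEdges {s(w, u)}).egirth := hG.trans (egirth_anti hle)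
    have h2x : ∀ p : (G.deleteEdges {s(w, u)}).Walk x w, g ≤ p.length + 1 :=
      fun p => (hlift (fun q => (hxw q).le) p).trans (Nat.le_succ _)
    have h2 := le_egirth_sup_edge h1 h2x
    have h3y : ∀ p : (G.deleteEdges {s(w, u)} ⊔ edge x w).Walk y u, g ≤ p.length + 1 := by
      intro p
      rcases p.split_of_sup_edge with ⟨q, hq⟩ | ⟨q₁, q₂, hq⟩ | ⟨q₁, q₂, hq⟩
      · have := hlift hyu q
        omega
      · have := hwu q₂
        omega
      · have := hlift hxu q₂
        omega
    have h3 := le_egirth_sup_edge h2 h3y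
    have hd : ∀ v, (((G.deleteEdges {s(w, u)} ⊔ edge x w) ⊔ edge y u).neighborSet v).ncard =
        (G.neighborSet v).ncard + (if v = x then 1 else 0) + (if v = y then 1 else 0) := by
      intro v
      rw [ncard_neighborSet_sup_edge (ne_of h3y) (nadj_of h3y),
        ncard_neighborSet_sup_edge (ne_of h2x) (nadj_of h2x), ncard_neighborSet_deleteEdges hu v]
      omega
    refine ⟨_, ?_, h3, fun v => (hd v).trans_le (hdeg v), ?_⟩
    · refine le_trans ?_ (le_sup_left.trans le_sup_left)
      intro a b hab
      rw [deleteEdges_adj, Set.mem_singleton_iff]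
      refine ⟨hFG hab, fun e => ?_⟩
      have hwS : w ∈ S := by
        rcases Sym2.eq_iff.1 e with ⟨rfl, rfl⟩ | ⟨rfl, rfl⟩
        · exact hFS _ _ hab
        · exact hFS _ _ hab.symm
      have := hfar w (by simp [hwS]) .nil
      simp at this
    · refine Finset.sum_lt_sum (fun v _ => by rw [hd v]; omega) ⟨x, Finset.mem_univ _, ?_⟩
      rw [hd x, if_pos rfl]
      omega

/-- **Erdős–Sachs**: a graph `F` of girth at least `g` on few of the vertices extends to a graph
of girth at least `g` with prescribed degrees. -/
theorem exists_extension_of_degrees [Fintype V] {F : SimpleGraph V} {g k : ℕ}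
    {δ : V → ℕ} (hg : 3 ≤ g) (hF : (g : ℕ∞) ≤ F.egirth) (hδk : ∀ v, δ v ≤ k)
    (hδ : ∀ v, 1 ≤ δ v) (heven : Even (∑ v, δ v)) (hFδ : ∀ v, (F.neighborSet v).ncard ≤ δ v)
    {S : Set V} (hFS : ∀ v w, F.Adj v w → v ∈ S)
    (hcard : (S.ncard + 2) * (k + 1) ^ g < Fintype.card V) :
    ∃ G : SimpleGraph V, F ≤ G ∧ (g : ℕ∞) ≤ G.egirth ∧ ∀ v, (G.neighborSet v).ncard = δ v := by
  classical
  obtain ⟨G, ⟨hFG, hG, hGδ⟩, hmax⟩ := Set.exists_max_image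
    {G : SimpleGraph V | F ≤ G ∧ (g : ℕ∞) ≤ G.egirth ∧ ∀ v, (G.neighborSet v).ncard ≤ δ v}
    (fun G => ∑ v, (G.neighborSet v).ncard) (Set.toFinite _) ⟨F, le_rfl, hF, hFδ⟩
  refine ⟨G, hFG, hG, ?_⟩
  by_contra! hne
  obtain ⟨x, hx⟩ := hne
  have hx' : (G.neighborSet x).ncard < δ x := lt_of_le_of_ne (hGδ x) hx
  obtain ⟨y, hy⟩ : ∃ y, ∀ w, (G.neighborSet w).ncard + (if w = x then 1 else 0) +
      (if w = y then 1 else 0) ≤ δ w := by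
    by_cases h : ∃ y, y ≠ x ∧ (G.neighborSet y).ncard < δ y
    · obtain ⟨y, hyx, hy⟩ := h
      refine ⟨y, fun w => ?_⟩
      have := hGδ w
      by_cases h1 : w = x
      · subst h1
        simp [hyx.symm]
        omega
      · by_cases h2 : w = y
        · subst h2
          simp [h1]
          omega
        · simpa [h1, h2]
    · push Not at h
      have heq : ∀ w ∈ Finset.univ.erase x, (G.neighborSet w).ncard = δ w := fun w hw =>
        le_antisymm (hGδ w) (h w (Finset.ne_of_mem_erase hw))
      have e1 : δ x + ∑ v ∈ Finset.univ.erase x, δ v = ∑ v, δ v :=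
        Finset.add_sum_erase Finset.univ δ (Finset.mem_univ x)
      have e2 : (G.neighborSet x).ncard + ∑ v ∈ Finset.univ.erase x, δ v =
          ∑ v, (G.neighborSet v).ncard := by
        rw [← Finset.sum_congr rfl heq]
        exact Finset.add_sum_erase Finset.univ (fun v => (G.neighborSet v).ncard)
          (Finset.mem_univ x)
      have e3 := even_sum_ncard_neighborSet G
      refine ⟨x, fun w => ?_⟩
      by_cases h1 : w = x
      · subst h1
        simp only [if_true]
        rw [Nat.even_iff] at heven e3
        omega
      · simpa [h1] using hGδ w
  obtain ⟨G', h1, h2, h3, h4⟩ := exists_augmentation hg hFG hG hδk hδ hFS hcard hy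
  exact absurd (hmax G' ⟨h1, h2, h3⟩) (by simpa using h4)

end Extremal

section Cycle

theorem cycleGraph_adj_iff_val {n : ℕ} (hn : 3 ≤ n) {u v : Fin n} :
    (cycleGraph n).Adj u v ↔ v.val = u.val + 1 ∨ u.val = v.val + 1 ∨
      (u.val = 0 ∧ v.val + 1 = n) ∨ (v.val = 0 ∧ u.val + 1 = n) := by
  have hu := u.isLt
  have hv := v.isLt
  rw [cycleGraph_adj', Fin.val_sub, Fin.val_sub]
  have key : ∀ a b : ℕ, a < n → b < n → ((n - b + a) % n = 1 ↔ a = b + 1 ∨ (a = 0 ∧ b + 1 = n)) := by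
    intro a b ha hb
    by_cases h : n - b + a < n
    · rw [Nat.mod_eq_of_lt h]; omega
    · rw [Nat.mod_eq_sub_mod (by omega), Nat.mod_eq_of_lt (by omega)]; omega
  rw [key _ _ hu hv, key _ _ hv hu]
  omega

theorem le_egirth_cycleGraph {n : ℕ} (hn : 3 ≤ n) : (n : ℕ∞) ≤ (cycleGraph n).egirth := by
  rw [natCast_le_egirth_iff]
  suffices h : ∀ u v : Fin n, (v.val = u.val + 1 ∨ (v.val = 0 ∧ u.val + 1 = n)) →
      ∀ p : ((cycleGraph n).deleteEdges {s(u, v)}).Walk v u, n ≤ p.length + 1 by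
    intro u v huv p
    rw [cycleGraph_adj_iff_val hn] at huv
    by_cases h' : v.val = u.val + 1 ∨ (v.val = 0 ∧ u.val + 1 = n)
    · simpa using h u v h' p.reverse
    · have := h v u (by omega)
      rw [Sym2.eq_swap] at this
      exact this p
  intro u v huv p
  have hu := u.isLt
  have := p.le_add_length_of_lipschitz
    (f := fun w => if v.val ≤ w.val then w.val - v.val else w.val + n - v.val) (by
      intro x y hxy
      rw [deleteEdges_adj, cycleGraph_adj_iff_val hn, Set.mem_singleton_iff, Sym2.eq_iff,
        Fin.ext_iff, Fin.ext_iff, Fin.ext_iff, Fin.ext_iff] at hxy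
      have hx := x.isLt
      have hy := y.isLt
      have hv := v.isLt
      split_ifs <;> omega)
  split_ifs at this <;> omega

theorem egirth_cycleGraph_le {n : ℕ} (hn : 3 ≤ n) : (cycleGraph n).egirth ≤ n := by
  obtain ⟨m, rfl⟩ := Nat.exists_eq_add_of_le' hn
  simpa [cycleGraph.length_cycle] using egirth_le_length (cycleGraph.isCycle_cycle (n := m))

theorem ncard_neighborSet_cycleGraph {n : ℕ} (hn : 3 ≤ n) (v : Fin n) :
    ((cycleGraph n).neighborSet v).ncard = 2 := by
  obtain ⟨m, rfl⟩ := Nat.exists_eq_add_of_le' hn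
  rw [Set.ncard_eq_toFinset_card']
  exact cycleGraph_degree_three_le

theorem cycleGraph_exists_walk_of_le {n : ℕ} (hn : 3 ≤ n) {u v : Fin n} (huv : u ≤ v) :
    ∃ p : (cycleGraph n).Walk u v, p.length = v.val - u.val := by
  obtain ⟨j, hj⟩ := v
  induction j with
  | zero =>
    have : u = ⟨0, hj⟩ := le_antisymm huv (Fin.le_def.2 (Nat.zero_le _))
    subst this
    exact ⟨.nil, by simp⟩
  | succ j ih =>
    rw [Fin.le_def] at huv
    simp only at huv
    by_cases h : u.val = j + 1
    · have : u = ⟨j + 1, hj⟩ := Fin.ext h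
      subst this
      exact ⟨.nil, by simp⟩
    · obtain ⟨p, hp⟩ := ih (by omega) (Fin.le_def.2 (by simp only; omega))
      refine ⟨p.concat ((cycleGraph_adj_iff_val hn).2 (by simp)), ?_⟩
      rw [Walk.length_concat, hp]
      simp only
      omega

theorem cycleGraph_exists_walk {m : ℕ} (hm : 2 ≤ m) (u v : Fin (2 * m)) :
    ∃ p : (cycleGraph (2 * m)).Walk u v, p.length ≤ m := by
  have hn : 3 ≤ 2 * m := by omega
  wlog huv : u ≤ v generalizing u v
  · obtain ⟨p, hp⟩ := this v u (le_of_not_ge huv)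
    exact ⟨p.reverse, by simpa using hp⟩
  obtain ⟨p, hp⟩ := cycleGraph_exists_walk_of_le hn huv
  by_cases h : p.length ≤ m
  · exact ⟨p, h⟩
  · obtain ⟨q, hq⟩ := cycleGraph_exists_walk_of_le hn
      (u := ⟨0, by omega⟩) (v := u) (Fin.le_def.2 (Nat.zero_le _))
    obtain ⟨r, hr⟩ := cycleGraph_exists_walk_of_le hn
      (u := v) (v := ⟨2 * m - 1, by omega⟩) (Fin.le_def.2 (by simp only; omega))
    refine ⟨q.reverse.append (.cons ((cycleGraph_adj_iff_val hn).2 ?_) r.reverse), ?_⟩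
    · exact .inr (.inr (.inl ⟨rfl, by dsimp only; omega⟩))
    · rw [Walk.length_append, Walk.length_cons, Walk.length_reverse, Walk.length_reverse, hq, hr]
      have : (⟨2 * m - 1, by omega⟩ : Fin (2 * m)).val = 2 * m - 1 := rfl
      have := v.isLt
      omega

theorem le_length_of_cycleGraph_walk {m : ℕ} (hm : 2 ≤ m)
    (p : (cycleGraph (2 * m)).Walk ⟨0, by omega⟩ ⟨m, by omega⟩) : m ≤ p.length := by
  have := p.le_add_length_of_lipschitz (f := fun w => if w.val ≤ m then w.val else 2 * m - w.val) (by
      intro x y hxy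
      rw [cycleGraph_adj_iff_val (by omega)] at hxy
      have hx := x.isLt
      have hy := y.isLt
      split_ifs <;> omega)
  simpa using this

end Cycle

section RootedProduct

variable {V I : Type*}

/-- The rooted product: one copy of `K` for each vertex of `R`, with the copies of the root `a`
joined as in `R`. -/
def rootedProduct (K : SimpleGraph V) (a : V) (R : SimpleGraph I) : SimpleGraph (V × I) where
  Adj x y := (x.2 = y.2 ∧ K.Adj x.1 y.1) ∨ (x.1 = a ∧ y.1 = a ∧ R.Adj x.2 y.2)
  symm := ⟨by
    rintro x y (⟨h, h'⟩ | ⟨h, h', h''⟩)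
    · exact .inl ⟨h.symm, h'.symm⟩
    · exact .inr ⟨h', h, h''.symm⟩⟩
  loopless := ⟨by
    rintro x (⟨-, h⟩ | ⟨-, -, h⟩)
    · exact K.irrefl h
    · exact R.irrefl h⟩

variable {K : SimpleGraph V} {a : V} {R : SimpleGraph I}

theorem rootedProduct_adj {x y : V × I} : (rootedProduct K a R).Adj x y ↔
    (x.2 = y.2 ∧ K.Adj x.1 y.1) ∨ (x.1 = a ∧ y.1 = a ∧ R.Adj x.2 y.2) := Iff.rfl

theorem le_egirth_rootedProduct {g : ℕ} (hK : (g : ℕ∞) ≤ K.egirth) (hR : (g : ℕ∞) ≤ R.egirth) :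
    (g : ℕ∞) ≤ (rootedProduct K a R).egirth := by
  classical
  rw [natCast_le_egirth_iff] at hK hR ⊢
  rintro ⟨u, i⟩ ⟨v, j⟩ huv p
  rcases huv with ⟨h, huv⟩ | ⟨h, h', hij⟩
  · simp only at h huv
    subst h
    obtain ⟨q, hq⟩ := p.exists_length_le_of_weakHom (H := K.deleteEdges {s(u, v)})
      (f := fun x => if x.2 = i then x.1 else a) (by
        rintro ⟨x, s⟩ ⟨y, t⟩ h
        rw [deleteEdges_adj, rootedProduct_adj] at h
        simp only [Set.mem_singleton_iff] at h
        rcases h with ⟨⟨rfl, h⟩ | ⟨rfl, rfl, h⟩, he⟩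
        · by_cases hs : s = i
          · subst hs
            right
            simp only [if_true, deleteEdges_adj, Set.mem_singleton_iff]
            refine ⟨h, fun e => he ?_⟩
            rcases Sym2.eq_iff.1 e with ⟨rfl, rfl⟩ | ⟨rfl, rfl⟩
            · rfl
            · exact Sym2.eq_swap
          · simp [hs]
        · simp)
    have := hK u v huv (q.copy (by simp) (by simp))
    simp at this
    omega
  · simp only at h h' hij
    subst h h'
    obtain ⟨q, hq⟩ := p.exists_length_le_of_weakHom (H := R.deleteEdges {s(i, j)})
      (f := Prod.snd) (by
        rintro ⟨x, s⟩ ⟨y, t⟩ h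
        rw [deleteEdges_adj, rootedProduct_adj] at h
        simp only [Set.mem_singleton_iff] at h
        rcases h with ⟨⟨rfl, h⟩ | ⟨rfl, rfl, h⟩, he⟩
        · exact .inl rfl
        · right
          simp only [deleteEdges_adj, Set.mem_singleton_iff]
          refine ⟨h, fun e => he ?_⟩
          rcases Sym2.eq_iff.1 e with ⟨rfl, rfl⟩ | ⟨rfl, rfl⟩
          · rfl
          · exact Sym2.eq_swap)
    have := hR i j hij q
    omega

theorem egirth_rootedProduct_le [Nonempty I] : (rootedProduct K a R).egirth ≤ K.egirth := by
  obtain ⟨i⟩ := ‹Nonempty I›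
  exact IsContained.egirth_le ⟨⟨⟨fun v => (v, i), fun h => .inl ⟨rfl, h⟩⟩,
    fun x y h => congrArg Prod.fst h⟩⟩

theorem ncard_neighborSet_rootedProduct [Finite V] [Finite I] (u : V) (i : I) [Decidable (u = a)] :
    ((rootedProduct K a R).neighborSet (u, i)).ncard =
      (K.neighborSet u).ncard + if u = a then (R.neighborSet i).ncard else 0 := by
  have hK : ((fun v => (v, i)) '' K.neighborSet u).ncard = (K.neighborSet u).ncard :=
    Set.ncard_image_of_injective _ fun x y h => congrArg Prod.fst h
  split_ifs with h
  · subst h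
    have hR : ((fun j => (u, j)) '' R.neighborSet i).ncard = (R.neighborSet i).ncard :=
      Set.ncard_image_of_injective _ fun x y h => congrArg Prod.snd h
    rw [← hK, ← hR, ← Set.ncard_union_eq]
    · congr 1
      ext ⟨v, j⟩
      simp only [mem_neighborSet, rootedProduct_adj, Set.mem_union, Set.mem_image, Prod.mk.injEq]
      grind
    · rw [Set.disjoint_left]
      rintro _ ⟨v, hv, rfl⟩ ⟨j, hj, h⟩
      simp only [Prod.mk.injEq] at h
      exact hv.ne h.1
  · rw [← hK, add_zero]
    congr 1
    ext ⟨v, j⟩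
    simp only [mem_neighborSet, rootedProduct_adj, Set.mem_image, Prod.mk.injEq]
    grind

theorem Connected.dist_le_succ_of_adj (hK : K.Connected) (w : V) {x y : V} (h : K.Adj x y) :
    K.dist w y ≤ K.dist w x + 1 := by
  rw [← dist_eq_one_iff_adj.2 h]
  exact hK.dist_triangle

theorem ediam_rootedProduct {m : ℕ} (hK : K.Connected) (hR : R.Connected)
    (hRm : ∀ i j, ∃ p : R.Walk i j, p.length ≤ m) {i₀ i₁ : I} (hi : i₀ ≠ i₁)
    (h₀ : ∀ p : R.Walk i₀ i₁, m ≤ p.length) {u : V} (hu : ∀ v, K.dist a v ≤ K.dist a u) :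
    (rootedProduct K a R).ediam = (2 * K.dist a u + m : ℕ) := by
  classical
  set e := K.dist a u with he
  refine le_antisymm (ediam_le_of_edist_le ?_) ?_
  · rintro ⟨v, i⟩ ⟨w, j⟩
    obtain ⟨p, hp⟩ := hK.exists_walk_length_eq_dist a v
    obtain ⟨q, hq⟩ := hK.exists_walk_length_eq_dist a w
    obtain ⟨r, hr⟩ := hRm i j
    have layer : ∀ s, ∀ x y, K.Adj x y → (x, s) = (y, s) ∨ (rootedProduct K a R).Adj (x, s) (y, s) :=
      fun s x y h => .inr (.inl ⟨rfl, h⟩)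
    obtain ⟨p', hp'⟩ := p.reverse.exists_length_le_of_weakHom (f := fun x => (x, i)) (layer i)
    obtain ⟨q', hq'⟩ := q.exists_length_le_of_weakHom (f := fun x => (x, j)) (layer j)
    obtain ⟨r', hr'⟩ := r.exists_length_le_of_weakHom (H := rootedProduct K a R)
      (f := fun s => (a, s)) (fun s t h => .inr (.inr ⟨rfl, rfl, h⟩))
    refine (edist_le (p'.append (r'.append q'))).trans ?_
    rw [Walk.length_reverse] at hp'
    have := hu v
    have := hu w
    rw [Walk.length_append, Walk.length_append]
    exact_mod_cast (by omega : p'.length + (r'.length + q'.length) ≤ 2 * e + m)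
  · refine le_trans ?_ (edist_le_ediam (u := (u, i₀)) (v := (u, i₁)))
    rw [edist_eq_sInf]
    refine le_sInf ?_
    rintro _ ⟨p, rfl⟩
    obtain ⟨r, hr⟩ := hR.exists_walk_length_eq_dist i₀ i₁
    have hm := h₀ r
    have key : ∀ s, (if s = i₁ then e + m + 0 else if s = i₀ then e - 0 else
        e + min m (R.dist i₀ s)) = e + min m (R.dist i₀ s) := by
      intro s
      split_ifs with h1 h2
      · subst h1
        omega
      · subst h2
        simp
      · rfl
    have := p.le_add_length_of_lipschitz (f := fun x => if x.2 = i₁ then e + m + K.dist a x.1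
      else if x.2 = i₀ then e - K.dist a x.1 else e + min m (R.dist i₀ x.2)) (by
        rintro ⟨x, s⟩ ⟨y, t⟩ (⟨h, h'⟩ | ⟨h, h', h''⟩)
        · dsimp only at h h' ⊢
          subst h
          have h1 := hK.dist_le_succ_of_adj a h'
          have h2 := hK.dist_le_succ_of_adj a h'.symm
          split_ifs <;> omega
        · dsimp only at h h' h'' ⊢
          subst h h'
          have h1 := hR.dist_le_succ_of_adj i₀ h''
          rw [dist_self, key, key]
          omega)
    rw [if_neg hi, if_pos rfl, if_pos rfl, ← he] at this
    exact Nat.cast_le.2 (by omega : 2 * e + m ≤ p.length)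

end RootedProduct

section Existence

theorem Iso.ediam_le {V W : Type*} {G : SimpleGraph V} {H : SimpleGraph W} (f : G ≃g H) :
    H.ediam ≤ G.ediam := by
  refine ediam_le_of_edist_le fun x y => ?_
  refine le_trans ?_ (edist_le_ediam (u := f.symm x) (v := f.symm y))
  rw [G.edist_eq_sInf]
  refine le_sInf ?_
  rintro _ ⟨p, rfl⟩
  have := edist_le (p.map f.toHom)
  simpa using this

theorem Iso.ediam_eq {V W : Type*} {G : SimpleGraph V} {H : SimpleGraph W} (f : G ≃g H) :
    G.ediam = H.ediam :=
  le_antisymm f.symm.ediam_le f.ediam_le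

theorem Iso.ncard_neighborSet {V W : Type*} {G : SimpleGraph V} {H : SimpleGraph W} (f : G ≃g H)
    (v : V) : (H.neighborSet (f v)).ncard = (G.neighborSet v).ncard := by
  rw [← Set.ncard_image_of_injective (G.neighborSet v) f.injective]
  congr 1
  ext w
  constructor
  · intro h
    exact ⟨f.symm w, by simpa [← f.map_adj_iff] using h, by simp⟩
  · rintro ⟨u, hu, rfl⟩
    exact f.map_adj_iff.2 hu

/-- A cycle of length `g` with one pendant vertex `inr b`, plus isolated vertices. -/
def pendantCycle (g : ℕ) [NeZero g] {B : Type*} (b : B) : SimpleGraph (Fin g ⊕ B) :=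
  (cycleGraph g).map Function.Embedding.inl ⊔ edge (.inl 0) (.inr b)

variable {g : ℕ} [NeZero g] {B : Type*} (b : B)

theorem le_egirth_pendantCycle (hg : 3 ≤ g) : (g : ℕ∞) ≤ (pendantCycle g b).egirth := by
  refine le_egirth_sup_edge ?_ ?_
  · rw [natCast_le_egirth_iff]
    intro x y hxy p
    rw [map_adj] at hxy
    obtain ⟨u, v, huv, rfl, rfl⟩ := hxy
    obtain ⟨q, hq⟩ : ∃ q : ((cycleGraph g).deleteEdges {s(u, v)}).Walk u v,
        q.length ≤ p.length := p.exists_length_le_of_weakHom (f := Sum.elim id fun _ => 0) (by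
        intro x y h
        rw [deleteEdges_adj, map_adj] at h
        obtain ⟨⟨x, y, h, rfl, rfl⟩, he⟩ := h
        right
        simp only [Function.Embedding.inl_apply, Sum.elim_inl, id_eq, deleteEdges_adj]
        refine ⟨h, fun e => he ?_⟩
        rw [Set.mem_singleton_iff] at e ⊢
        rcases Sym2.eq_iff.1 e with ⟨rfl, rfl⟩ | ⟨rfl, rfl⟩
        · rfl
        · exact Sym2.eq_swap)
    have := natCast_le_egirth_iff.1 (le_egirth_cycleGraph hg) u v huv q
    omega
  · intro p
    have := p.le_add_length_of_lipschitz (f := Sum.elim (fun _ => 0) fun _ => g) (by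
      intro x y h
      rw [map_adj] at h
      obtain ⟨x, y, h, rfl, rfl⟩ := h
      simp)
    simp at this
    omega

theorem ncard_neighborSet_pendantCycle_le [Finite B] (hg : 3 ≤ g) (v : Fin g ⊕ B) :
    ((pendantCycle g b).neighborSet v).ncard ≤ 3 := by
  classical
  rw [pendantCycle, ncard_neighborSet_sup_edge (by simp) (by simp [map_adj])]
  rcases v with v | v
  · have : ((cycleGraph g).map Function.Embedding.inl).neighborSet (.inl v : Fin g ⊕ B) =
        Sum.inl '' (cycleGraph g).neighborSet v := by
      ext w
      simp [map_adj]
    rw [this, Set.ncard_image_of_injective _ Sum.inl_injective, ncard_neighborSet_cycleGraph hg]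
    simp
    split_ifs <;> omega
  · have : ((cycleGraph g).map Function.Embedding.inl).neighborSet (.inr v : Fin g ⊕ B) = ∅ := by
      ext w
      simp [map_adj]
    rw [this]
    simp
    split_ifs <;> omega

theorem neighborSet_pendantCycle_root :
    (pendantCycle g b).neighborSet (.inr b) = {.inl 0} := by
  ext w
  simp [pendantCycle, map_adj, edge_adj]
  grind

theorem exists_rooted_graph {k g : ℕ} (hk : 3 ≤ k) (hg : 3 ≤ g) :
    ∃ (V : Type) (_ : Fintype V) (_ : DecidableEq V) (K : SimpleGraph V) (a : V), K.Connected ∧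
      K.egirth = g ∧ ∀ v, (K.neighborSet v).ncard = if v = a then k - 2 else k := by
  classical
  have : NeZero g := ⟨by omega⟩
  set T := (g + 3) * (k + 1) ^ g with hT
  set B := Fin (g + 2 * (T + 1)) with hB
  set b : B := ⟨0, by omega⟩
  set δ : Fin g ⊕ B → ℕ := fun v => if v = .inr b then k - 2 else k with hδ
  have hVcard : Fintype.card (Fin g ⊕ B) = 2 * (g + (T + 1)) := by
    simp [hB]
    omega
  set S : Set (Fin g ⊕ B) := insert (.inr b) (Set.range .inl) with hS
  have hScard : S.ncard ≤ g + 1 := by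
    refine (Set.ncard_insert_le _ _).trans ?_
    rw [← Set.image_univ, Set.ncard_image_of_injective _ Sum.inl_injective]
    simp
  obtain ⟨G, hFG, hG, hGδ⟩ := exists_extension_of_degrees (F := pendantCycle g b) (k := k)
    (δ := δ) (S := S) hg (le_egirth_pendantCycle b hg)
    (fun v => by simp only [hδ]; split_ifs <;> omega)
    (fun v => by simp only [hδ]; split_ifs <;> omega) (by
      have : ∑ v, (δ v + if v = .inr b then 2 else 0) = 2 * (g + (T + 1)) * k := by
        refine (Finset.sum_congr rfl (g := fun _ => k) fun v _ => ?_).trans ?_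
        · simp only [hδ]
          split_ifs <;> omega
        · rw [Finset.sum_const, Finset.card_univ, hVcard, smul_eq_mul]
      rw [Finset.sum_add_distrib, Finset.sum_ite_eq' Finset.univ, if_pos (Finset.mem_univ _),
        mul_assoc] at this
      rw [Nat.even_iff]
      omega) (fun v => by
      by_cases h : v = .inr b
      · subst h
        rw [neighborSet_pendantCycle_root, Set.ncard_singleton]
        simp only [hδ, if_true]
        omega
      · simp only [hδ, h, if_false]
        exact (ncard_neighborSet_pendantCycle_le b hg v).trans hk) (by
      intro v w h
      rw [pendantCycle, sup_adj, map_adj, edge_adj] at h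
      simp only [hS, Set.mem_insert_iff, Set.mem_range]
      rcases h with ⟨u, v, h, rfl, rfl⟩ | ⟨⟨rfl, rfl⟩ | ⟨rfl, rfl⟩, -⟩
      · exact .inr ⟨u, rfl⟩
      · exact .inr ⟨_, rfl⟩
      · exact .inl rfl) (by
      have := Nat.mul_le_mul_right ((k + 1) ^ g) (Nat.add_le_add_right hScard 2)
      rw [hVcard]
      change _ ≤ T at this
      omega)
  set C := G.connectedComponentMk (.inr b) with hC
  have hcyc : ∀ u v, (cycleGraph g).Adj u v → G.Adj (.inl u) (.inl v) := fun u v h =>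
    hFG (.inl (by rw [map_adj]; exact ⟨u, v, h, rfl, rfl⟩))
  have hmem : ∀ v : Fin g, Sum.inl v ∈ C.supp := by
    intro v
    rw [ConnectedComponent.mem_supp_iff, hC, ConnectedComponent.eq]
    have h0 : G.Adj (.inl 0) (.inr b) := hFG (.inr (by simp [edge_adj]))
    refine Reachable.trans ?_ h0.reachable
    have hconn : (cycleGraph g).Preconnected := cycleGraph_preconnected
    exact (hconn v 0).map (⟨.inl, fun {u v} h => hcyc u v h⟩ : cycleGraph g →g G)
  have hbmem : Sum.inr b ∈ C.supp := (ConnectedComponent.mem_supp_iff _ _).2 rfl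
  refine ⟨C.supp, inferInstance, inferInstance, C.toSimpleGraph, ⟨.inr b, hbmem⟩,
    C.connected_toSimpleGraph, le_antisymm ?_ ?_, ?_⟩
  · refine le_trans ?_ (egirth_cycleGraph_le hg)
    exact IsContained.egirth_le ⟨⟨⟨fun v => ⟨.inl v, hmem v⟩, fun {u v} h => hcyc u v h⟩,
      fun x y h => Sum.inl_injective (congrArg Subtype.val h)⟩⟩
  · refine hG.trans ?_
    exact IsContained.egirth_le ⟨⟨C.toSimpleGraph_hom, Subtype.val_injective⟩⟩
  · rintro ⟨v, hv⟩
    rw [← Set.ncard_image_of_injective _ Subtype.val_injective]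
    have : Subtype.val '' (C.toSimpleGraph.neighborSet ⟨v, hv⟩) = G.neighborSet v := by
      ext w
      constructor
      · rintro ⟨⟨w, hw⟩, h, rfl⟩
        exact h
      · intro h
        exact ⟨⟨w, C.mem_supp_of_adj_mem_supp hv h⟩, h, rfl⟩
    refine (congrArg Set.ncard this).trans ((hGδ v).trans ?_)
    simp only [hδ, Subtype.mk.injEq]

theorem exists_kgd_graph {k g : ℕ} (hk : 3 ≤ k) (hg : 3 ≤ g) :
    ∃ N d₀ : ℕ, ∀ d, d₀ ≤ d → ∃ n ≤ N * d, ∃ G : SimpleGraph (Fin n), IsKGDGraph k g d G := by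
  obtain ⟨V, _, _, K, a, hK, hKg, hdeg⟩ := exists_rooted_graph hk hg
  have : Nonempty V := ⟨a⟩
  obtain ⟨u, hu⟩ := Finite.exists_max (K.dist a)
  refine ⟨Fintype.card V * 2, 2 * K.dist a u + g, fun d hd => ?_⟩
  obtain ⟨m, rfl⟩ := Nat.exists_eq_add_of_le (show 2 * K.dist a u ≤ d by omega)
  have : NeZero (2 * m) := ⟨by omega⟩
  set H := rootedProduct K a (cycleGraph (2 * m)) with hH
  have hcard : Fintype.card (V × Fin (2 * m)) = Fintype.card V * (2 * m) := by simp
  refine ⟨Fintype.card V * (2 * m), ?_, H.overFin hcard, ?_, ?_, ?_⟩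
  · rw [mul_assoc]
    gcongr
    omega
  · intro x
    obtain ⟨⟨v, i⟩, rfl⟩ := (H.overFinIso hcard).surjective x
    rw [Iso.ncard_neighborSet, hH, ncard_neighborSet_rootedProduct, hdeg,
      ncard_neighborSet_cycleGraph (by omega)]
    split_ifs <;> omega
  · rw [← (H.overFinIso hcard).egirth_eq]
    refine le_antisymm (egirth_rootedProduct_le.trans hKg.le) (le_egirth_rootedProduct hKg.ge ?_)
    refine le_trans ?_ (le_egirth_cycleGraph (by omega))
    exact_mod_cast (by omega : g ≤ 2 * m)
  · rw [← (H.overFinIso hcard).ediam_eq]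
    have : (cycleGraph (2 * m)).Connected := ⟨cycleGraph_preconnected⟩
    exact ediam_rootedProduct hK this (cycleGraph_exists_walk (by omega))
      (i₀ := ⟨0, by omega⟩) (i₁ := ⟨m, by omega⟩) (by simp [Fin.ext_iff]; omega)
      (le_length_of_cycleGraph_walk (by omega)) hu

end Existence

section LowerBound

variable {V : Type*}

theorem le_two_mul_add_two_of_adj_of_adj {H : SimpleGraph V} {g i : ℕ}
    (hH : (g : ℕ∞) ≤ H.egirth) {x w z₁ z₂ : V} (h₁ : H.Adj w z₁) (h₂ : H.Adj w z₂)
    (hne : z₁ ≠ z₂) (hw : (i : ℕ∞) ≤ H.edist x w) (p₁ : H.Walk x z₁) (p₂ : H.Walk x z₂)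
    (hp₁ : p₁.length ≤ i) (hp₂ : p₂.length ≤ i) : g ≤ 2 * i + 2 := by
  classical
  have key : ∀ {z : V}, H.Adj w z → ∀ p : H.Walk x z, p.length ≤ i → w ∉ p.support := by
    intro z hz p hp hmem
    have h1 := p.length_takeUntil_lt_length hmem hz.ne
    have h2 : (i : ℕ∞) ≤ (p.takeUntil w hmem).length := hw.trans (edist_le _)
    have h3 : i ≤ (p.takeUntil w hmem).length := by exact_mod_cast h2
    omega
  have k₁ := key h₁ p₁ hp₁
  have k₂ := key h₂ p₂ hp₂
  have := natCast_le_egirth_iff.1 hH w z₁ h₁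
    ((Walk.cons h₂ (p₂.reverse.append p₁)).toDeleteEdge s(w, z₁) (by
      simp only [Walk.edges_cons, Walk.edges_append, Walk.edges_reverse, List.mem_cons,
        List.mem_append, List.mem_reverse, not_or]
      refine ⟨fun e => hne ?_, fun h => k₂ ?_, fun h => k₁ ?_⟩
      · rcases Sym2.eq_iff.1 e with ⟨-, h⟩ | ⟨rfl, rfl⟩
        · exact h
        · rfl
      · exact p₂.fst_mem_support_of_mem_edges h
      · exact p₁.fst_mem_support_of_mem_edges h))
  simp only [Walk.toDeleteEdge, Walk.toDeleteEdges, Walk.length_transfer, Walk.length_cons,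
    Walk.length_append, Walk.length_reverse] at this
  omega

theorem edist_le_edist_add_one_of_adj {H : SimpleGraph V} (x : V) {w z : V} (h : H.Adj w z) :
    H.edist x z ≤ H.edist x w + 1 :=
  H.edist_triangle.trans (by rw [edist_eq_one_iff_adj.2 h])

theorem le_ncard_edist_le [Finite V] {H : SimpleGraph V} {g q r D : ℕ} {x : V}
    (hH : (g : ℕ∞) ≤ H.egirth) (hr : 2 * r < g) (hx : D ≤ (H.neighborSet x).ncard)
    (hdeg : ∀ w, w ≠ x → H.edist x w < r → q + 1 ≤ (H.neighborSet w).ncard) :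
    1 + D * ∑ i ∈ Finset.range r, q ^ i ≤ {w | H.edist x w ≤ r}.ncard := by
  classical
  have := Fintype.ofFinite V
  set L : ℕ → Finset V := fun i => {w | H.edist x w = i} with hL
  have mem : ∀ i w, w ∈ L i ↔ H.edist x w = i := fun i w => by simp [hL]
  have walk : ∀ {i : ℕ} {w : V}, H.edist x w ≤ i → ∃ p : H.Walk x w, p.length ≤ i := by
    intro i w h
    obtain ⟨p, hp⟩ := exists_walk_of_edist_ne_top (ne_top_of_le_ne_top (ENat.natCast_ne_top i) h)
    exact ⟨p, by rw [← hp] at h; exact_mod_cast h⟩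
  have step : ∀ i, 1 ≤ i → i + 1 ≤ r → (L i).card * q ≤ (L (i + 1)).card * 1 := by
    intro i hi hir
    refine Finset.card_mul_le_card_mul H.Adj (fun w hw => ?_) (fun z hz => ?_)
    · rw [mem] at hw
      have hd := hdeg w (by
        rintro rfl
        rw [edist_self] at hw
        have : 0 = i := by exact_mod_cast hw
        omega) (by rw [hw]; exact_mod_cast (by omega : i < r))
      have hrest : ((H.neighborSet w) \ (L (i + 1) : Set V)).ncard ≤ 1 := by
        rw [Set.ncard_le_one]
        intro z₁ h₁ z₂ h₂
        by_contra hne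
        have close : ∀ z ∈ (H.neighborSet w) \ (L (i + 1) : Set V), H.edist x z ≤ i := by
          rintro z ⟨hz, hz'⟩
          have h1 := edist_le_edist_add_one_of_adj x hz
          rw [hw] at h1
          rw [Finset.mem_coe, mem] at hz'
          exact Order.le_of_lt_add_one (lt_of_le_of_ne h1 (by exact_mod_cast hz'))
        obtain ⟨p₁, hp₁⟩ := walk (close z₁ h₁)
        obtain ⟨p₂, hp₂⟩ := walk (close z₂ h₂)
        have := le_two_mul_add_two_of_adj_of_adj hH h₁.1 h₂.1 hne hw.ge p₁ p₂ hp₁ hp₂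
        omega
      have hle : (H.neighborSet w ∩ (L (i + 1) : Set V)).ncard =
          (Finset.bipartiteAbove H.Adj (L (i + 1)) w).card := by
        rw [← Set.ncard_coe_finset]
        congr 1
        ext z
        simp [Finset.bipartiteAbove, and_comm]
      have := Set.ncard_inter_add_ncard_sdiff_eq_ncard (H.neighborSet w) (L (i + 1) : Set V)
      omega
    · rw [mem] at hz
      rw [Finset.card_le_one]
      intro w₁ h₁ w₂ h₂
      by_contra hne
      simp only [Finset.bipartiteBelow, Finset.mem_filter, mem] at h₁ h₂
      obtain ⟨p₁, hp₁⟩ := walk h₁.1.le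
      obtain ⟨p₂, hp₂⟩ := walk h₂.1.le
      have := le_two_mul_add_two_of_adj_of_adj hH h₁.2.symm h₂.2.symm hne
        (by rw [hz]; exact_mod_cast i.le_succ) p₁ p₂ hp₁ hp₂
      omega
  have level : ∀ i, i + 1 ≤ r → D * q ^ i ≤ (L (i + 1)).card := by
    intro i
    induction i with
    | zero =>
      intro _
      rw [pow_zero, mul_one]
      refine hx.trans ?_
      rw [← Set.ncard_coe_finset]
      refine Set.ncard_le_ncard fun w hw => ?_
      rw [Finset.mem_coe, mem]
      simpa using edist_eq_one_iff_adj.2 hw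
    | succ i ih =>
      intro h
      have h1 := step (i + 1) (by omega) h
      rw [mul_one] at h1
      rw [pow_succ, ← mul_assoc]
      exact (Nat.mul_le_mul_right q (ih (by omega))).trans h1
  have ball : ∀ s, s ≤ r → 1 + D * ∑ i ∈ Finset.range s, q ^ i ≤
      {w | H.edist x w ≤ s}.ncard := by
    intro s
    induction s with
    | zero =>
      intro _
      simp [edist_eq_zero_iff]
    | succ s ih =>
      intro hs
      have hdis : Disjoint {w | H.edist x w ≤ s} (L (s + 1) : Set V) := by
        rw [Set.disjoint_left]
        intro w h1 h2
        rw [Finset.mem_coe, mem] at h2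
        rw [Set.mem_ofPred_eq, h2] at h1
        have : s + 1 ≤ s := by exact_mod_cast h1
        omega
      have hsub : {w | H.edist x w ≤ s} ∪ (L (s + 1) : Set V) ⊆
          {w | H.edist x w ≤ (s + 1 : ℕ)} := by
        rintro w (h | h)
        · rw [Set.mem_ofPred_eq] at h
          exact h.trans (by exact_mod_cast s.le_succ)
        · rw [Finset.mem_coe, mem] at h
          exact h.le
      have h1 := Set.ncard_le_ncard hsub
      rw [Set.ncard_union_eq hdis, Set.ncard_coe_finset] at h1
      have h2 := level s hs
      have h3 := ih (by omega)
      rw [Finset.sum_range_succ, mul_add]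
      omega
  exact ball r le_rfl

theorem mooreBound_le_ncard [Finite V] {G : SimpleGraph V} {k g : ℕ} (hk : 3 ≤ k) (hg : 3 ≤ g)
    (hreg : IsRegular' k G) (hG : (g : ℕ∞) ≤ G.egirth) {f : V → ℕ}
    (hf : ∀ x y, G.Adj x y → f y ≤ f x + 1) {x y : V} (hxy : G.Adj x y) (hfxy : f y = f x + 1) :
    mooreBound k g ≤ {w | f x ≤ f w + (g - 1) / 2 ∧ f w ≤ f x + g / 2}.ncard := by
  classical
  have near : ∀ {H : SimpleGraph V}, H ≤ G → ∀ {z w : V} {r : ℕ}, H.edist z w ≤ r →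
      f w ≤ f z + r ∧ f z ≤ f w + r := by
    intro H hHG z w r h
    obtain ⟨p, hp⟩ := exists_walk_of_edist_ne_top (ne_top_of_le_ne_top (ENat.natCast_ne_top r) h)
    have hp : p.length ≤ r := by rw [← hp] at h; exact_mod_cast h
    have h1 := p.le_add_length_of_lipschitz fun a b hab => hf a b (hHG hab)
    have h2 := p.reverse.le_add_length_of_lipschitz fun a b hab => hf a b (hHG hab)
    rw [Walk.length_reverse] at h2
    omega
  rcases Nat.even_or_odd' g with ⟨t, rfl | rfl⟩
  · have hM : mooreBound k (2 * t : ℕ) = 2 * ∑ i ∈ Finset.range t, (k - 1) ^ i := by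
      rw [mooreBound, if_neg (by omega), if_neg (by omega)]
      congr 3
      omega
    obtain ⟨r, rfl⟩ : ∃ r, t = r + 1 := ⟨t - 1, by omega⟩
    set H := G.deleteEdges {s(x, y)} with hH
    have hHG : H ≤ G := deleteEdges_le _
    have hHg : ((2 * (r + 1) : ℕ) : ℕ∞) ≤ H.egirth := hG.trans (egirth_anti hHG)
    have hdegH : ∀ v, (G.neighborSet v).ncard = (H.neighborSet v).ncard +
        (if v = x then 1 else 0) + (if v = y then 1 else 0) :=
      fun v => ncard_neighborSet_deleteEdges hxy v
    have far : ∀ s : ℕ, H.edist x y ≤ s → 2 * r + 1 ≤ s := by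
      intro s h
      obtain ⟨p, hp⟩ := exists_walk_of_edist_ne_top (ne_top_of_le_ne_top (ENat.natCast_ne_top s) h)
      have hp : p.length ≤ s := by rw [← hp] at h; exact_mod_cast h
      have := natCast_le_egirth_iff.1 hG x y hxy p
      omega
    have hsum : ∑ i ∈ Finset.range (r + 1), (k - 1) ^ i =
        1 + (k - 1) * ∑ i ∈ Finset.range r, (k - 1) ^ i := by
      rw [Finset.sum_range_succ', Finset.mul_sum, add_comm]
      simp [pow_succ']
    have hX := le_ncard_edist_le (x := x) (D := k - 1) (q := k - 1) (r := r) hHg (by omega) (by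
      have := hdegH x
      rw [hreg x, if_pos rfl, if_neg hxy.ne] at this
      omega) (fun w hw h => by
      have h1 := hdegH w
      rw [hreg w, if_neg hw, if_neg (by
        rintro rfl
        have := far r h.le
        omega)] at h1
      omega)
    have hY := le_ncard_edist_le (x := y) (D := k - 1) (q := k - 1) (r := r) hHg (by omega) (by
      have := hdegH y
      rw [hreg y, if_pos rfl, if_neg hxy.ne'] at this
      omega) (fun w hw h => by
      have h1 := hdegH w
      rw [hreg w, if_neg hw, if_neg (by
        rintro rfl
        have := far r (by rw [edist_comm]; exact h.le)
        omega)] at h1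
      omega)
    have hdis : Disjoint {w | H.edist x w ≤ r} {w | H.edist y w ≤ r} := by
      rw [Set.disjoint_left]
      intro w h1 h2
      have := far (r + r) (by
        push_cast
        exact H.edist_triangle.trans (add_le_add h1 (by rw [edist_comm]; exact h2)))
      omega
    rw [hM, hsum, two_mul]
    refine (add_le_add hX hY).trans ?_
    rw [← Set.ncard_union_eq hdis]
    refine Set.ncard_le_ncard ?_
    rintro w (h | h)
    · have := near hHG h
      simp only [Set.mem_ofPred_eq]
      omega
    · have := near hHG h
      simp only [Set.mem_ofPred_eq]
      omega
  · have hM : mooreBound k (2 * t + 1 : ℕ) = 1 + k * ∑ i ∈ Finset.range t, (k - 1) ^ i := by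
      rw [mooreBound, if_neg (by omega), if_pos (by omega)]
      congr 4
      omega
    rw [hM]
    refine (le_ncard_edist_le hG (by omega) (hreg x).ge fun w _ _ => ?_).trans
      (Set.ncard_le_ncard ?_)
    · rw [hreg w]
      omega
    · intro w h
      have := near le_rfl h
      simp only [Set.mem_ofPred_eq]
      omega

theorem mooreBound_mul_div_le_card {n k g d : ℕ} (hk : 3 ≤ k) (hg : 3 ≤ g)
    {G : SimpleGraph (Fin n)} (hG : IsKGDGraph k g d G) (hd : g ≤ d) :
    mooreBound k g * (d / g) ≤ n := by
  classical
  obtain ⟨hreg, hgirth, hdiam⟩ := hG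
  have hn : Nonempty (Fin n) := by
    by_contra h
    rw [not_nonempty_iff] at h
    rw [ediam_eq_zero_of_subsingleton] at hdiam
    have : 0 = d := by exact_mod_cast hdiam
    omega
  have hconn : G.Connected := connected_of_ediam_ne_top (by simp [hdiam])
  obtain ⟨u, v, huv⟩ := G.exists_edist_eq_ediam_of_finite
  rw [hdiam] at huv
  obtain ⟨p, hp⟩ := exists_walk_of_edist_ne_top (huv ▸ ENat.natCast_ne_top d)
  have hp : p.length = d := by rw [huv] at hp; exact_mod_cast hp
  have huv' : G.dist u v = d := by rw [dist, huv]; rfl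
  have hlip : ∀ x y, G.Adj x y → G.dist u y ≤ G.dist u x + 1 :=
    fun x y h => hconn.dist_le_succ_of_adj u h
  have hvert : ∀ i ≤ d, G.dist u (p.getVert i) = i := by
    intro i hi
    have h1 := (p.take i).le_add_length_of_lipschitz hlip
    have h2 := (p.drop i).le_add_length_of_lipschitz hlip
    rw [dist_self, Walk.take_length] at h1
    rw [Walk.drop_length, huv'] at h2
    omega
  set W : ℕ → Finset (Fin n) := fun j =>
    {w | g * j ≤ G.dist u w + (g - 1) / 2 ∧ G.dist u w ≤ g * j + g / 2} with hW
  have hWcard : ∀ j ∈ Finset.range (d / g), mooreBound k g ≤ (W j).card := by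
    intro j hj
    rw [Finset.mem_range] at hj
    have hjd : g * (j + 1) ≤ d :=
      (Nat.mul_le_mul_left g hj).trans (Nat.mul_div_le d g)
    rw [mul_add_one] at hjd
    have h1 := hvert (g * j) (by omega)
    have h2 := hvert (g * j + 1) (by omega)
    have := mooreBound_le_ncard hk hg hreg hgirth.ge hlip
      (p.adj_getVert_succ (i := g * j) (by omega)) (by rw [h1, h2])
    rw [h1] at this
    rw [← Set.ncard_coe_finset]
    simpa [hW] using this
  have hdis : Set.PairwiseDisjoint (Finset.range (d / g) : Set ℕ) W := by
    intro i _ j _ hij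
    rw [Function.onFun, Finset.disjoint_left]
    intro w hi hj
    simp only [hW, Finset.mem_filter, Finset.mem_univ, true_and] at hi hj
    rcases Nat.lt_or_gt_of_ne hij with h | h
    · have := Nat.mul_le_mul_left g (Nat.succ_le_of_lt h)
      rw [Nat.mul_succ] at this
      omega
    · have := Nat.mul_le_mul_left g (Nat.succ_le_of_lt h)
      rw [Nat.mul_succ] at this
      omega
  calc mooreBound k g * (d / g) = (Finset.range (d / g)).card • mooreBound k g := by
        rw [Finset.card_range, smul_eq_mul, mul_comm]
    _ ≤ ∑ j ∈ Finset.range (d / g), (W j).card := Finset.card_nsmul_le_sum _ _ _ hWcard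
    _ = ((Finset.range (d / g)).biUnion W).card := (Finset.card_biUnion hdis).symm
    _ ≤ n := (Finset.card_le_univ _).trans_eq (Fintype.card_fin n)

end LowerBound

end SimpleGraph

theorem fRatio_lower_bound (k g : ℕ) (hk : 3 ≤ k) (hg : 3 ≤ g) :
    (mooreBound k g : ℝ) / g ≤ fRatio k g := by
  refine le_csInf ?_ ?_
  · obtain ⟨N, d₀, h⟩ := SimpleGraph.exists_kgd_graph hk hg
    refine ⟨N, 0, d₀, fun d hd => ?_⟩
    obtain ⟨n, hn, G, hG⟩ := h d hd
    exact ⟨n, by rw [add_zero]; exact_mod_cast hn, G, hG⟩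
  · rintro c ⟨C, d₀, h⟩
    have hg0 : (0 : ℝ) < g := by exact_mod_cast (by omega : 0 < g)
    set M : ℝ := (mooreBound k g : ℝ) with hM
    by_contra! hc
    obtain ⟨m, hm⟩ := exists_nat_gt ((C + M) / (M / g - c))
    rw [div_lt_iff₀ (sub_pos.2 hc)] at hm
    set d := max m (max d₀ g) with hd
    obtain ⟨n, hn, G, hG⟩ := h d (by omega)
    have h1 : M * (d / g : ℕ) ≤ n := by
      rw [hM]
      exact_mod_cast SimpleGraph.mooreBound_mul_div_le_card hk hg hG (by omega)
    have h2 : (d : ℝ) / g ≤ (d / g : ℕ) + 1 := by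
      rw [← Nat.floor_div_eq_div (K := ℝ)]
      exact (Nat.lt_floor_add_one _).le
    have h3 : M * (d / g) ≤ M * ((d / g : ℕ) + 1) :=
      mul_le_mul_of_nonneg_left h2 (Nat.cast_nonneg _)
    have h4 : (m : ℝ) ≤ d := by exact_mod_cast le_max_left _ _
    have h5 := mul_le_mul_of_nonneg_right h4 (sub_pos.2 hc).le
    have h6 : (d : ℝ) * (M / g - c) = M * (d / g) - c * d := by ring
    linarith
end
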